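/- There exists a parameter λ ∈ ℂ with λ ≠ 0 such that (i) the real parts of the iterates of the singular value 0 tend to infinity, i.e. Re(f_λ^n(0)) → ∞ as n → ∞ (in particular |f_λ^n(0)| → ∞, so λ is an escaping parameter), and (ii) f_λ is ergodic with respect to the planar Lebesgue measure: every Lebesgue-measurable set A ⊆ ℂ with f_λ^{-1}(A) = A satisfies that either A or its complement ℂ \ A has Lebesgue measure zero. -/

import Mathlib

open MeasureTheory Filter

namespace ExpErgodic

open Complex Metric Set Topology

/-- The exponential map `z ↦ l * exp z`. -/
noncomputable def expMap (l z : ℂ) : ℂ := l * exp z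

/-- The modulus of the derivative of the `n`-th iterate of `expMap l` at `z`. -/
noncomputable def dnorm (l : ℂ) (n : ℕ) (z : ℂ) : ℝ :=
  ∏ i ∈ Finset.range n, ‖(expMap l)^[i + 1] z‖

/-- The sum of the moduli of the derivatives, at `(expMap l)^[n] z`, of the inverse branches
along the orbit of `z`; it controls the distortion of the `n`-th iterate near `z`. -/
noncomputable def pullSum (l : ℂ) : ℕ → ℂ → ℝ
  | 0, _ => 0
  | n + 1, z => (pullSum l n z + 1) / ‖(expMap l)^[n + 1] z‖

variable {l : ℂ}

lemma expMap_ne_zero (hl : l ≠ 0) (z : ℂ) : expMap l z ≠ 0 :=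
  mul_ne_zero hl (exp_ne_zero z)

lemma iterate_succ_ne_zero (hl : l ≠ 0) (n : ℕ) (z : ℂ) : (expMap l)^[n + 1] z ≠ 0 := by
  rw [Function.iterate_succ_apply']
  exact expMap_ne_zero hl _

lemma iterate_succ_norm_pos (hl : l ≠ 0) (n : ℕ) (z : ℂ) : 0 < ‖(expMap l)^[n + 1] z‖ :=
  norm_pos_iff.2 (iterate_succ_ne_zero hl n z)

lemma norm_expMap (z : ℂ) : ‖expMap l z‖ = ‖l‖ * Real.exp z.re := by
  simp [expMap, norm_exp]

lemma hasDerivAt_expMap (z : ℂ) : HasDerivAt (expMap l) (expMap l z) z := by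
  exact (hasDerivAt_exp z).const_mul l

lemma hasDerivAt_iterate (n : ℕ) (z : ℂ) :
    HasDerivAt ((expMap l)^[n]) (∏ i ∈ Finset.range n, (expMap l)^[i + 1] z) z := by
  induction n with
  | zero => simpa using hasDerivAt_id z
  | succ n ih =>
    rw [Finset.prod_range_succ, mul_comm, Function.iterate_succ', Function.comp_apply]
    exact (hasDerivAt_expMap _).comp z ih

lemma norm_prod_iterate (n : ℕ) (z : ℂ) :
    ‖∏ i ∈ Finset.range n, (expMap l)^[i + 1] z‖ = dnorm l n z := by
  simp [dnorm]

lemma differentiable_iterate (n : ℕ) : Differentiable ℂ ((expMap l)^[n]) :=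
  fun z => (hasDerivAt_iterate n z).differentiableAt

lemma continuous_iterate (n : ℕ) : Continuous ((expMap l)^[n]) :=
  (differentiable_iterate n).continuous

lemma dnorm_zero (z : ℂ) : dnorm l 0 z = 1 := by simp [dnorm]

lemma dnorm_succ (n : ℕ) (z : ℂ) :
    dnorm l (n + 1) z = dnorm l n z * ‖(expMap l)^[n + 1] z‖ := by
  simp [dnorm, Finset.prod_range_succ]

lemma dnorm_pos (hl : l ≠ 0) (n : ℕ) (z : ℂ) : 0 < dnorm l n z :=
  Finset.prod_pos fun i _ => iterate_succ_norm_pos hl i z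

lemma pullSum_nonneg (n : ℕ) (z : ℂ) : 0 ≤ pullSum l n z := by
  induction n with
  | zero => simp [pullSum]
  | succ n ih => rw [pullSum]; positivity

lemma dnorm_le_pullSum_mul (hl : l ≠ 0) (z : ℂ) {i n : ℕ} (h : i < n) :
    dnorm l i z ≤ pullSum l n z * dnorm l n z := by
  induction n with
  | zero => omega
  | succ n ih =>
    have hp := iterate_succ_norm_pos hl n z
    have e : pullSum l (n + 1) z * dnorm l (n + 1) z
        = pullSum l n z * dnorm l n z + dnorm l n z := by
      rw [pullSum, dnorm_succ]; field_simp
    rw [e]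
    have h1 := dnorm_pos hl n z
    have h2 := mul_nonneg (pullSum_nonneg (l := l) n z) h1.le
    rcases Nat.lt_succ_iff_lt_or_eq.1 h with h | rfl
    · linarith [ih h]
    · linarith

/-- Inverse branches of iterates, with a distortion bound. -/
lemma exists_branch (hl : l ≠ 0) (n : ℕ) (v ζ : ℂ)
    (h : ‖ζ - (expMap l)^[n] v‖ * pullSum l n v < 1) :
    ∃ v', (expMap l)^[n] v' = ζ ∧
      ‖v' - v‖ * (dnorm l n v * (1 - ‖ζ - (expMap l)^[n] v‖ * pullSum l n v))
        ≤ ‖ζ - (expMap l)^[n] v‖ ∧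
      dnorm l n v * (1 - ‖ζ - (expMap l)^[n] v‖ * pullSum l n v) ≤ dnorm l n v' ∧
      dnorm l n v' * (1 - ‖ζ - (expMap l)^[n] v‖ * pullSum l n v) ≤ dnorm l n v := by
  induction n generalizing ζ with
  | zero => exact ⟨ζ, by simp [pullSum, dnorm]⟩
  | succ n ih =>
    set w := (expMap l)^[n + 1] v with hw
    have hw0 : w ≠ 0 := iterate_succ_ne_zero hl n v
    have hwp : 0 < ‖w‖ := norm_pos_iff.2 hw0
    have hT := pullSum_nonneg (l := l) n v
    set T := pullSum l n v with hTdef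
    set x := (ζ - w) / w with hx
    set p := ‖x‖ with hp
    have hpe : ‖ζ - w‖ = p * ‖w‖ := by rw [hp, hx, norm_div]; field_simp
    have hsT : ‖ζ - w‖ * pullSum l (n + 1) v = p * (T + 1) := by
      rw [pullSum, hpe, ← hw, ← hTdef]; field_simp
    rw [hsT] at h ⊢
    have hp0 : 0 ≤ p := norm_nonneg _
    have hp1 : p < 1 := by nlinarith
    have hq : 0 < 1 - p := by linarith
    have hlog : ‖log (1 + x)‖ ≤ p / (1 - p) := by
      refine (norm_log_one_add_le hp1).trans ?_
      rw [← hp, le_div_iff₀ hq]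
      have : p ^ 2 * (1 - p)⁻¹ / 2 * (1 - p) = p ^ 2 / 2 := by field_simp
      nlinarith
    have hx1 : 1 + x ≠ 0 := by
      intro h0
      have : x = -1 := by linear_combination h0
      rw [hp, this] at hp1; simp at hp1
    set ξ := (expMap l)^[n] v + log (1 + x) with hξ
    have hfξ : expMap l ξ = ζ := by
      have : expMap l ξ = w * (1 + x) := by
        rw [hξ, expMap, exp_add, exp_log hx1, hw, Function.iterate_succ_apply', expMap]; ring
      rw [this, hx]; field_simp; ring
    have hs' : ‖ξ - (expMap l)^[n] v‖ ≤ p / (1 - p) := by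
      rw [hξ, add_sub_cancel_left]; exact hlog
    set s' := ‖ξ - (expMap l)^[n] v‖ with hs'def
    have hs0 : 0 ≤ s' := norm_nonneg _
    have hkey : s' * T * (1 - p) ≤ p * T := by
      have : s' * (1 - p) ≤ p := (le_div_iff₀ hq).1 hs'
      nlinarith
    have hs'p : s' * (1 - p) ≤ p := (le_div_iff₀ hq).1 hs'
    obtain ⟨v', h1, h2, h3, h4⟩ := ih ξ (by
      by_contra hc
      push Not at hc
      nlinarith)
    have hζ : (expMap l)^[n + 1] v' = ζ := by
      rw [Function.iterate_succ_apply', h1, hfξ]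
    have hζn : ζ = w * (1 + x) := by rw [hx]; field_simp; ring
    have hup : ‖ζ‖ ≤ ‖w‖ * (1 + p) := by
      rw [hζn, norm_mul]; gcongr; simpa using norm_add_le 1 x
    have hlo : ‖w‖ * (1 - p) ≤ ‖ζ‖ := by
      rw [hζn, norm_mul]; gcongr
      have := norm_sub_norm_le (1 : ℂ) (-x)
      simpa using this
    have hD := dnorm_pos hl n v
    have hD' := dnorm_pos hl n v'
    have hone : 1 - p * (T + 1) ≤ (1 - s' * T) * (1 - p) := by nlinarith
    refine ⟨v', hζ, ?_, ?_, ?_⟩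
    · rw [dnorm_succ, ← hw, hpe]
      have h5 : ‖v' - v‖ * (dnorm l n v * (1 - p * (T + 1))) ≤ p := by
        calc ‖v' - v‖ * (dnorm l n v * (1 - p * (T + 1)))
            ≤ ‖v' - v‖ * (dnorm l n v * ((1 - s' * T) * (1 - p))) := by gcongr
          _ = (‖v' - v‖ * (dnorm l n v * (1 - s' * T))) * (1 - p) := by ring
          _ ≤ s' * (1 - p) := by gcongr
          _ ≤ p := hs'p
      calc _ = (‖v' - v‖ * (dnorm l n v * (1 - p * (T + 1)))) * ‖w‖ := by ring
        _ ≤ p * ‖w‖ := by gcongr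
    · rw [dnorm_succ, dnorm_succ, hζ, ← hw]
      calc dnorm l n v * ‖w‖ * (1 - p * (T + 1))
          ≤ dnorm l n v * ‖w‖ * ((1 - s' * T) * (1 - p)) := by gcongr
        _ = (dnorm l n v * (1 - s' * T)) * (‖w‖ * (1 - p)) := by ring
        _ ≤ dnorm l n v' * ‖ζ‖ := by gcongr
    · rw [dnorm_succ, dnorm_succ, hζ, ← hw]
      have h6 : 0 ≤ 1 - p * (T + 1) := by linarith
      have h7 : 0 ≤ 1 - s' * T := by
        by_contra hc
        push Not at hc
        nlinarith
      calc dnorm l n v' * ‖ζ‖ * (1 - p * (T + 1))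
          ≤ dnorm l n v' * (‖w‖ * (1 + p)) * ((1 - s' * T) * (1 - p)) := by gcongr
        _ = (dnorm l n v' * (1 - s' * T)) * ‖w‖ * (1 - p ^ 2) := by ring
        _ ≤ dnorm l n v * ‖w‖ * 1 := by
            gcongr
            · nlinarith
            · nlinarith
        _ = dnorm l n v * ‖w‖ := mul_one _

lemma hasStrictDerivAt_iterate (n : ℕ) (z : ℂ) :
    HasStrictDerivAt ((expMap l)^[n]) (∏ i ∈ Finset.range n, (expMap l)^[i + 1] z) z := by
  have h := (differentiable_iterate (l := l) n).analyticAt z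
  have := h.hasStrictDerivAt
  rwa [(hasDerivAt_iterate n z).deriv] at this

lemma prod_iterate_ne_zero (hl : l ≠ 0) (n : ℕ) (z : ℂ) :
    ∏ i ∈ Finset.range n, (expMap l)^[i + 1] z ≠ 0 :=
  Finset.prod_ne_zero_iff.2 fun i _ => iterate_succ_ne_zero hl i z

lemma iterate_mem_iff {E : Set ℂ} (hinv : expMap l ⁻¹' E = E) (n : ℕ) (z : ℂ) :
    (expMap l)^[n] z ∈ E ↔ z ∈ E := by
  induction n generalizing z with
  | zero => rfl
  | succ n ih =>
    rw [Function.iterate_succ_apply, ih]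
    exact Set.ext_iff.1 hinv z

/-- Multiplication by a complex number as a real linear map. -/
noncomputable def mulR (a : ℂ) : ℂ →L[ℝ] ℂ :=
  ((1 : ℂ →L[ℂ] ℂ).smulRight a).restrictScalars ℝ

lemma det_mulR (a : ℂ) : (mulR a).det = ‖a‖ ^ 2 := by
  rw [← Complex.normSq_eq_norm_sq, ← Algebra.norm_complex_apply, Algebra.norm_apply]
  rw [ContinuousLinearMap.det]
  congr 1
  ext z
  simp [mulR, mul_comm]

lemma hasFDerivWithinAt_mulR {g : ℂ → ℂ} {a z : ℂ} {s : Set ℂ} (h : HasDerivWithinAt g a s z) :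
    HasFDerivWithinAt g (mulR a) s z :=
  h.hasFDerivWithinAt.restrictScalars ℝ

/-- Translating the image of an iterate by `c` can be lifted to the domain, with small
distortion. -/
lemma volume_translate_le (hl : l ≠ 0) {E : Set ℂ} (hE : MeasurableSet E)
    (hinv : expMap l ⁻¹' E = E) {n : ℕ} (hn : 1 ≤ n) {G0 G : Set ℂ} (hG0 : IsOpen G0)
    (hinj : InjOn ((expMap l)^[n]) G0) (hG : MeasurableSet G) {c : ℂ} {τ : ℝ} (hτ : τ ≤ 1 / 2)
    (hT : ∀ v ∈ G, ‖c‖ * pullSum l n v ≤ τ) (hball : ∀ v ∈ G, closedBall v (2 * τ) ⊆ G0) :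
    ENNReal.ofReal ((1 - τ) ^ 2) * volume {v | v ∈ G ∧ (expMap l)^[n] v + c ∈ E}
      ≤ volume (E ∩ G0) := by
  have hex : ∀ v ∈ G, ∃ v' ∈ G0, (expMap l)^[n] v' = (expMap l)^[n] v + c ∧
      dnorm l n v' * (1 - τ) ≤ dnorm l n v := by
    intro v hv
    have h0 : (expMap l)^[n] v + c - (expMap l)^[n] v = c := by ring
    have hTv := hT v hv
    have hD := dnorm_pos hl n v
    obtain ⟨v', h1, h2, h3, h4⟩ := exists_branch hl n v ((expMap l)^[n] v + c)
      (by rw [h0]; linarith)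
    rw [h0] at h2 h3 h4
    refine ⟨v', hball v hv ?_, h1, ?_⟩
    · rw [mem_closedBall, dist_eq_norm]
      have h5 := dnorm_le_pullSum_mul hl v (i := 0) (n := n) (by omega)
      rw [dnorm_zero] at h5
      have h6 : ‖c‖ ≤ τ * dnorm l n v := by
        calc ‖c‖ = ‖c‖ * 1 := (mul_one _).symm
          _ ≤ ‖c‖ * (pullSum l n v * dnorm l n v) := by gcongr
          _ = (‖c‖ * pullSum l n v) * dnorm l n v := by ring
          _ ≤ _ := by gcongr
      have h7 : ‖v' - v‖ * (1 / 2) * dnorm l n v ≤ τ * dnorm l n v := by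
        calc ‖v' - v‖ * (1 / 2) * dnorm l n v = ‖v' - v‖ * (dnorm l n v * (1 / 2)) := by ring
          _ ≤ ‖v' - v‖ * (dnorm l n v * (1 - ‖c‖ * pullSum l n v)) := by gcongr; linarith
          _ ≤ _ := h2.trans h6
      have := le_of_mul_le_mul_right h7 hD
      linarith
    · refine le_trans ?_ h4
      have := dnorm_pos hl n v'
      gcongr
  choose! ψ hψ0 hψF hψD using hex
  set F := (expMap l)^[n] with hF
  have hder : ∀ v ∈ G, HasDerivWithinAt ψ ((∏ i ∈ Finset.range n, (expMap l)^[i + 1] (ψ v))⁻¹ *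
      ∏ i ∈ Finset.range n, (expMap l)^[i + 1] v) G v := by
    intro v hv
    have hs := hasStrictDerivAt_iterate (l := l) n (ψ v)
    have hne := prod_iterate_ne_zero hl n (ψ v)
    have hg := (hs.to_localInverse hne).hasDerivAt
    have hr := hs.eventually_right_inverse hne
    have hl' : hs.localInverse _ _ _ hne (F (ψ v)) = ψ v :=
      (hs.eventually_left_inverse hne).self_of_nhds
    set g := hs.localInverse _ _ _ hne
    rw [← hF] at hr hg
    have hgG : ∀ᶠ y in 𝓝 (F (ψ v)), g y ∈ G0 := by
      apply hg.continuousAt.eventually_mem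
      rw [hl']
      exact hG0.mem_nhds (hψ0 v hv)
    rw [hψF v hv] at hr hg hgG
    have hF' : HasDerivAt (fun z => F z + c) (∏ i ∈ Finset.range n, (expMap l)^[i + 1] v) v :=
      (hasDerivAt_iterate n v).add_const c
    have hcomp := HasDerivAt.comp v hg hF'
    refine hcomp.hasDerivWithinAt.congr_of_eventuallyEq_of_mem ?_ hv
    have hev := hF'.continuousAt.eventually (hr.and hgG)
    filter_upwards [nhdsWithin_le_nhds hev, self_mem_nhdsWithin] with v' h1 h2
    refine hinj (hψ0 v' h2) h1.2 ?_
    exact (hψF v' h2).trans h1.1.symm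
  set G1 := {v | v ∈ G ∧ F v + c ∈ E} with hG1
  have hG1m : MeasurableSet G1 :=
    hG.inter (((continuous_iterate n).measurable.add_const c) hE)
  have hsub : G1 ⊆ G := fun v hv => hv.1
  have hGG0 : G ⊆ G0 := fun v hv => hball v hv (mem_closedBall_self (by
    have := hT v hv
    have := mul_nonneg (norm_nonneg c) (pullSum_nonneg (l := l) n v)
    linarith))
  have hinjψ : InjOn ψ G1 := by
    intro v1 h1 v2 h2 h12
    refine hinj (hGG0 h1.1) (hGG0 h2.1) ?_
    have e1 := hψF v1 h1.1
    have e2 := hψF v2 h2.1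
    rw [h12, e2] at e1
    exact (add_right_cancel e1).symm
  have hcov := lintegral_abs_det_fderiv_eq_addHaar_image volume hG1m
    (fun v hv => hasFDerivWithinAt_mulR ((hder v (hsub hv)).mono hsub)) hinjψ
  calc ENNReal.ofReal ((1 - τ) ^ 2) * volume G1
      = ∫⁻ _ in G1, ENNReal.ofReal ((1 - τ) ^ 2) := by rw [setLIntegral_const]
    _ ≤ ∫⁻ v in G1, ENNReal.ofReal |(mulR ((∏ i ∈ Finset.range n, (expMap l)^[i + 1] (ψ v))⁻¹ *
          ∏ i ∈ Finset.range n, (expMap l)^[i + 1] v)).det| := by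
        refine setLIntegral_mono' hG1m fun v hv => ENNReal.ofReal_le_ofReal ?_
        rw [det_mulR, norm_mul, norm_inv, norm_prod_iterate, norm_prod_iterate]
        refine le_trans ?_ (le_abs_self _)
        have := dnorm_pos hl n (ψ v)
        have h1 : 1 - τ ≤ (dnorm l n (ψ v))⁻¹ * dnorm l n v := by
          rw [inv_mul_eq_div, le_div_iff₀ this, mul_comm]
          exact hψD v hv.1
        have : 0 ≤ 1 - τ := by linarith
        gcongr
    _ = volume (ψ '' G1) := hcov
    _ ≤ volume (E ∩ G0) := by
        refine measure_mono ?_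
        rintro _ ⟨v, hv, rfl⟩
        refine ⟨?_, hψ0 v hv.1⟩
        rw [← iterate_mem_iff hinv n, ← hF, hψF v hv.1]
        exact hv.2

/-- The proportion of the invariant set `E` in a domain is at least, up to distortion, the average
of its proportions in the cells `f^n v + C`. -/
lemma lintegral_cell_le (hl : l ≠ 0) {E : Set ℂ} (hE : MeasurableSet E)
    (hinv : expMap l ⁻¹' E = E) {n : ℕ} (hn : 1 ≤ n) {G0 G C : Set ℂ} (hG0 : IsOpen G0)
    (hinj : InjOn ((expMap l)^[n]) G0) (hG : MeasurableSet G) (hC : MeasurableSet C)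
    {τ h : ℝ} (hτ : τ ≤ 1 / 2) (hCh : ∀ c ∈ C, ‖c‖ ≤ h)
    (hT : ∀ v ∈ G, h * pullSum l n v ≤ τ) (hball : ∀ v ∈ G, closedBall v (2 * τ) ⊆ G0) :
    ENNReal.ofReal ((1 - τ) ^ 2) *
      ∫⁻ v in G, volume {c | c ∈ C ∧ (expMap l)^[n] v + c ∈ E} ≤ volume (E ∩ G0) * volume C := by
  set F := (expMap l)^[n] with hF
  have hFm : Measurable F := (continuous_iterate n).measurable
  set S : Set (ℂ × ℂ) := {p | p.1 ∈ G ∧ p.2 ∈ C ∧ F p.1 + p.2 ∈ E} with hS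
  have hSm : MeasurableSet S :=
    (measurable_fst hG).inter ((measurable_snd hC).inter
      (((hFm.comp measurable_fst).add measurable_snd) hE))
  have h1 := Measure.prod_apply (μ := (volume : Measure ℂ)) (ν := (volume : Measure ℂ)) hSm
  have h2 := Measure.prod_apply_symm (μ := (volume : Measure ℂ)) (ν := (volume : Measure ℂ)) hSm
  rw [h1] at h2
  have h3 : ∫⁻ v in G, volume {c | c ∈ C ∧ F v + c ∈ E} ≤ ∫⁻ x, volume (Prod.mk x ⁻¹' S) := by
    refine le_trans (setLIntegral_mono' hG fun v hv => ?_) (setLIntegral_le_lintegral G _)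
    exact measure_mono fun c hc => ⟨hv, hc.1, hc.2⟩
  have h4 : ENNReal.ofReal ((1 - τ) ^ 2) * ∫⁻ y, volume ((fun x => (x, y)) ⁻¹' S)
      ≤ volume (E ∩ G0) * volume C := by
    rw [← lintegral_const_mul' _ _ ENNReal.ofReal_ne_top, ← setLIntegral_const,
      ← lintegral_indicator hC]
    refine lintegral_mono fun c => ?_
    by_cases hc : c ∈ C
    · rw [indicator_of_mem hc]
      refine le_trans ?_ (volume_translate_le hl hE hinv hn hG0 hinj hG (c := c) hτ ?_ hball)
      · gcongr
        intro v hv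
        exact ⟨hv.1, hv.2.2⟩
      · intro v hv
        refine le_trans ?_ (hT v hv)
        have := pullSum_nonneg (l := l) n v
        gcongr
        exact hCh c hc
    · rw [indicator_of_notMem hc]
      have : (fun x => (x, c)) ⁻¹' S = ∅ := by
        ext x; simp [hS, hc]
      simp [this]
  refine le_trans ?_ h4
  rw [← h2]
  gcongr

/-- If the invariant set `E` occupies a proportion at least `η` of every cell `f^n v + C`, `v ∈ G`,
then it occupies nearly such a proportion of `G`. -/
lemma mul_volume_le (hl : l ≠ 0) {E : Set ℂ} (hE : MeasurableSet E)
    (hinv : expMap l ⁻¹' E = E) {n : ℕ} (hn : 1 ≤ n) {G0 G C : Set ℂ} (hG0 : IsOpen G0)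
    (hG0f : volume G0 ≠ ⊤)
    (hinj : InjOn ((expMap l)^[n]) G0) (hG : MeasurableSet G) (hC : MeasurableSet C)
    (hC0 : volume C ≠ 0) (hC1 : volume C ≠ ⊤) {τ h : ℝ} (hτ0 : 0 ≤ τ) (hτ : τ ≤ 1 / 2)
    (hCh : ∀ c ∈ C, ‖c‖ ≤ h)
    (hT : ∀ v ∈ G, h * pullSum l n v ≤ τ) (hball : ∀ v ∈ G, closedBall v (2 * τ) ⊆ G0)
    {η : ℝ} (hη0 : 0 ≤ η)
    (hη : ∀ v ∈ G, η * volume.real C ≤ volume.real {c | c ∈ C ∧ (expMap l)^[n] v + c ∈ E}) :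
    (1 - τ) ^ 2 * (η * volume.real G) ≤ volume.real (E ∩ G0) := by
  have h1 := lintegral_cell_le hl hE hinv hn hG0 hinj hG hC hτ hCh hT hball
  have hGG0 : G ⊆ G0 := fun v hv => hball v hv (mem_closedBall_self (by linarith))
  have h2 : ENNReal.ofReal η * volume C * volume G ≤
      ∫⁻ v in G, volume {c | c ∈ C ∧ (expMap l)^[n] v + c ∈ E} := by
    rw [← setLIntegral_const]
    refine setLIntegral_mono' hG fun v hv => ?_
    have h3 : volume {c | c ∈ C ∧ (expMap l)^[n] v + c ∈ E} ≠ ⊤ :=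
      ne_top_of_le_ne_top hC1 (measure_mono fun c hc => hc.1)
    rw [← ENNReal.ofReal_toReal hC1, ← ENNReal.ofReal_toReal h3, ← ENNReal.ofReal_mul hη0]
    exact ENNReal.ofReal_le_ofReal (hη v hv)
  have h4 : ENNReal.ofReal ((1 - τ) ^ 2) * (ENNReal.ofReal η * volume G) ≤ volume (E ∩ G0) := by
    rw [← ENNReal.mul_le_mul_iff_left hC0 hC1]
    refine le_trans ?_ h1
    refine le_trans (le_of_eq ?_) (mul_le_mul_right h2 _)
    ring
  have h5 : volume (E ∩ G0) ≠ ⊤ := ne_top_of_le_ne_top hG0f (measure_mono inter_subset_right)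
  have h6 := ENNReal.toReal_mono h5 h4
  rwa [ENNReal.toReal_mul, ENNReal.toReal_mul, ENNReal.toReal_ofReal (by positivity),
    ENNReal.toReal_ofReal hη0] at h6

lemma dnorm_zero_le (hA : ∀ n, 200 ≤ ‖(expMap l)^[n + 1] 0‖) {i j : ℕ} (h : i ≤ j) :
    dnorm l i 0 ≤ dnorm l j 0 := by
  have hp : ∀ i, 0 ≤ dnorm l i 0 := fun i => Finset.prod_nonneg fun _ _ => norm_nonneg _
  refine monotone_nat_of_le_succ (f := fun i => dnorm l i 0) (fun i => ?_) h
  change dnorm l i 0 ≤ dnorm l (i + 1) 0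
  rw [dnorm_succ]
  nlinarith [hA i, hp i]

lemma norm_expMap_sub_le_and_le_mul {u : ℂ} {i : ℕ}
    (hx : ‖u‖ * dnorm l i 0 ≤ 1 / 8)
    (h1 : ‖(expMap l)^[i] u - (expMap l)^[i] 0‖ ≤
      ‖u‖ * dnorm l i 0 * (1 + ‖u‖ * dnorm l i 0 / 25))
    (h2 : dnorm l i 0 * (1 - ‖u‖ * dnorm l i 0 / 25) ≤ dnorm l i u) :
    ‖(expMap l)^[i + 1] u - (expMap l)^[i + 1] 0‖ ≤
      ‖u‖ * dnorm l (i + 1) 0 * (1 + 2 * (‖u‖ * dnorm l i 0)) ∧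
    dnorm l (i + 1) 0 * (1 - 2 * (‖u‖ * dnorm l i 0)) ≤ dnorm l (i + 1) u ∧
    ‖(expMap l)^[i + 1] 0‖ * (1 - 2 * (‖u‖ * dnorm l i 0)) ≤ ‖(expMap l)^[i + 1] u‖ ∧
    ‖(expMap l)^[i + 1] u‖ ≤ ‖(expMap l)^[i + 1] 0‖ * (1 + 2 * (‖u‖ * dnorm l i 0)) := by
  have hp : 0 ≤ dnorm l i 0 := Finset.prod_nonneg fun _ _ => norm_nonneg _
  have hpu : 0 ≤ dnorm l i u := Finset.prod_nonneg fun _ _ => norm_nonneg _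
  set x := ‖u‖ * dnorm l i 0 with hxd
  have hx0 : 0 ≤ x := by positivity
  set δ := (expMap l)^[i] u - (expMap l)^[i] 0 with hδ
  have hδx : ‖δ‖ ≤ 1.005 * x := by nlinarith
  have hδ1 : ‖δ‖ ≤ 1 := by linarith
  have heq : (expMap l)^[i + 1] u = (expMap l)^[i + 1] 0 * exp δ := by
    rw [Function.iterate_succ_apply', Function.iterate_succ_apply', hδ, expMap, expMap, exp_sub]
    field_simp
  have hexp : ‖exp δ - 1‖ ≤ x * (1 + 2 * x) := by
    have h3 := Complex.norm_exp_sub_one_sub_id_le hδ1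
    have h4 : ‖exp δ - 1‖ ≤ ‖exp δ - 1 - δ‖ + ‖δ‖ := by
      simpa using norm_add_le (exp δ - 1 - δ) δ
    have h0 := norm_nonneg δ
    have h5 : ‖δ‖ ^ 2 ≤ (1.005 * x) ^ 2 := by gcongr
    nlinarith
  have hx2 : x * (1 + 2 * x) ≤ 2 * x := by nlinarith
  have hlo : 1 - 2 * x ≤ ‖exp δ‖ := by
    have := norm_sub_norm_le (1 : ℂ) (1 - exp δ)
    rw [norm_sub_rev 1 (exp δ)] at this
    simp at this
    linarith
  have hlo' : 1 - 1.005 * x ≤ ‖exp δ‖ := by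
    rw [norm_exp]
    have h3 := Real.add_one_le_exp δ.re
    have h4 := (abs_le.1 (abs_re_le_norm δ)).1
    linarith
  have hhi : ‖exp δ‖ ≤ 1 + 2 * x := by
    have := norm_add_le (1 : ℂ) (exp δ - 1)
    simp at this
    linarith
  have hZ := norm_nonneg ((expMap l)^[i + 1] 0)
  refine ⟨?_, ?_, ?_, ?_⟩
  · have : (expMap l)^[i + 1] u - (expMap l)^[i + 1] 0 = (expMap l)^[i + 1] 0 * (exp δ - 1) := by
      rw [heq]; ring
    rw [this, norm_mul, dnorm_succ]
    calc _ ≤ ‖(expMap l)^[i + 1] 0‖ * (x * (1 + 2 * x)) := by gcongr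
      _ = _ := by rw [hxd]; ring
  · rw [dnorm_succ, dnorm_succ, heq, norm_mul]
    have h3 : dnorm l i 0 * (1 - 2 * x) ≤ dnorm l i u * ‖exp δ‖ := by
      calc dnorm l i 0 * (1 - 2 * x) ≤ dnorm l i 0 * ((1 - x / 25) * (1 - 1.005 * x)) := by
            gcongr; nlinarith
        _ = dnorm l i 0 * (1 - x / 25) * (1 - 1.005 * x) := by ring
        _ ≤ _ := by
            have : 0 ≤ 1 - 1.005 * x := by linarith
            gcongr
    calc _ = (dnorm l i 0 * (1 - 2 * x)) * ‖(expMap l)^[i + 1] 0‖ := by ring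
      _ ≤ (dnorm l i u * ‖exp δ‖) * ‖(expMap l)^[i + 1] 0‖ := by gcongr
      _ = _ := by ring
  · rw [heq, norm_mul]; gcongr
  · rw [heq, norm_mul]; gcongr

/-- Orbits starting near `0` shadow the orbit of `0` (a precise inductive form). -/
lemma norm_iterate_sub_le_and_le_dnorm (hA : ∀ n, 200 ≤ ‖(expMap l)^[n + 1] 0‖) {u : ℂ} (i : ℕ)
    (hx : ‖u‖ * dnorm l i 0 ≤ 1 / 8) :
    ‖(expMap l)^[i] u - (expMap l)^[i] 0‖ ≤
      ‖u‖ * dnorm l i 0 * (1 + ‖u‖ * dnorm l i 0 / 25) ∧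
    dnorm l i 0 * (1 - ‖u‖ * dnorm l i 0 / 25) ≤ dnorm l i u := by
  induction i with
  | zero =>
    simp only [dnorm_zero, Function.iterate_zero, id_eq, sub_zero, mul_one]
    constructor <;> nlinarith [norm_nonneg u]
  | succ i ih =>
    have hp : ∀ i, 0 ≤ dnorm l i 0 := fun i => Finset.prod_nonneg fun _ _ => norm_nonneg _
    have hle : ‖u‖ * dnorm l i 0 ≤ ‖u‖ * dnorm l (i + 1) 0 := by
      gcongr; exact dnorm_zero_le hA (by omega)
    obtain ⟨h1, h2⟩ := ih (hle.trans hx)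
    obtain ⟨h3, h4, -, -⟩ := norm_expMap_sub_le_and_le_mul (hle.trans hx) h1 h2
    have h5 : 2 * (‖u‖ * dnorm l i 0) ≤ ‖u‖ * dnorm l (i + 1) 0 / 25 := by
      rw [dnorm_succ]
      have := hA i
      have h0 : 0 ≤ ‖u‖ * dnorm l i 0 := mul_nonneg (norm_nonneg _) (hp i)
      nlinarith
    have h6 := hp (i + 1)
    refine ⟨h3.trans ?_, le_trans ?_ h4⟩
    · gcongr
    · gcongr

/-- Orbits starting near `0` shadow the orbit of `0`. -/
lemma shadow (hA : ∀ n, 200 ≤ ‖(expMap l)^[n + 1] 0‖) {u : ℂ} {m : ℕ}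
    (hx : ‖u‖ * dnorm l m 0 ≤ 1 / 8) {i : ℕ} (hi : i ≤ m) :
    ‖(expMap l)^[i + 1] u - (expMap l)^[i + 1] 0‖ ≤
      ‖u‖ * dnorm l (i + 1) 0 * (1 + 2 * (‖u‖ * dnorm l i 0)) ∧
    dnorm l (i + 1) 0 * (1 - 2 * (‖u‖ * dnorm l i 0)) ≤ dnorm l (i + 1) u ∧
    ‖(expMap l)^[i + 1] 0‖ * (1 - 2 * (‖u‖ * dnorm l i 0)) ≤ ‖(expMap l)^[i + 1] u‖ ∧
    ‖(expMap l)^[i + 1] u‖ ≤ ‖(expMap l)^[i + 1] 0‖ * (1 + 2 * (‖u‖ * dnorm l i 0)) := by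
  have hle : ‖u‖ * dnorm l i 0 ≤ 1 / 8 := by
    refine le_trans ?_ hx
    gcongr; exact dnorm_zero_le hA hi
  obtain ⟨h1, h2⟩ := norm_iterate_sub_le_and_le_dnorm hA i hle
  exact norm_expMap_sub_le_and_le_mul hle h1 h2

lemma pow_le_dnorm (hA : ∀ n, 200 ≤ ‖(expMap l)^[n + 1] 0‖) (n : ℕ) :
    (200 : ℝ) ^ n ≤ dnorm l n 0 := by
  induction n with
  | zero => simp [dnorm_zero]
  | succ n ih => rw [dnorm_succ, pow_succ]; exact mul_le_mul ih (hA n) (by norm_num) ((by positivity : (0 : ℝ) ≤ 200 ^ n).trans ih)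

lemma exists_scale (hA : ∀ n, 200 ≤ ‖(expMap l)^[n + 1] 0‖) {ρ : ℝ} (h0 : 0 < ρ)
    (h1 : ρ < 1 / 100) : ∃ m, ρ * dnorm l m 0 < 1 / 100 ∧ 1 / 100 ≤ ρ * dnorm l (m + 1) 0 := by
  classical
  have hex : ∃ n, 1 / 100 ≤ ρ * dnorm l n 0 := by
    obtain ⟨n, hn⟩ := pow_unbounded_of_one_lt (1 / ρ) (show (1 : ℝ) < 200 by norm_num)
    refine ⟨n, ?_⟩
    have h2 := hn.le.trans (pow_le_dnorm hA n)
    rw [div_le_iff₀ h0] at h2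
    linarith
  have hs := Nat.find_spec hex
  set k := Nat.find hex with hk
  rcases Nat.eq_zero_or_pos k with h | h
  · rw [h, dnorm_zero] at hs; linarith
  · refine ⟨k - 1, ?_, by rwa [Nat.sub_add_cancel h]⟩
    have := Nat.find_min hex (m := k - 1) (by omega)
    push Not at this
    exact this

/-- Control of `pullSum` along an orbit segment that stays away from the unit disc. -/
lemma pullSum_add_le (hl : l ≠ 0) (n : ℕ) (v : ℂ) {i : ℕ}
    (h : ∀ j ≤ i, 2 ≤ ‖(expMap l)^[n + (j + 1)] v‖) :
    pullSum l (n + (i + 1)) v ≤ pullSum l n v / dnorm l (i + 1) ((expMap l)^[n] v)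
      + 2 / ‖(expMap l)^[n + (i + 1)] v‖ := by
  have hT := pullSum_nonneg (l := l) n v
  induction i with
  | zero =>
    have h0 := iterate_succ_norm_pos hl n v
    rw [dnorm_succ, dnorm_zero, zero_add, one_mul, ← Function.iterate_add_apply, add_comm 1 n,
      pullSum, ← add_div]
    gcongr
    norm_num
  | succ i ih =>
    have h1 := ih fun j hj => h j (by omega)
    have h2 := h i (by omega)
    have h3 := iterate_succ_norm_pos hl (n + (i + 1)) v
    have h4 := dnorm_pos hl (i + 1) ((expMap l)^[n] v)
    rw [show n + (i + 1 + 1) = n + (i + 1) + 1 by ring, pullSum, dnorm_succ,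
      ← Function.iterate_add_apply, show i + 1 + 1 + n = n + (i + 1) + 1 by ring]
    have h5 : 2 / ‖(expMap l)^[n + (i + 1)] v‖ ≤ 1 := by
      rw [div_le_one (by linarith)]; exact h2
    calc _ ≤ (pullSum l n v / dnorm l (i + 1) ((expMap l)^[n] v) + 2)
          / ‖(expMap l)^[n + (i + 1) + 1] v‖ :=
          div_le_div_of_nonneg_right (by linarith) h3.le
      _ = _ := by field_simp

lemma dnorm_zero_pos (hA : ∀ n, 200 ≤ ‖(expMap l)^[n + 1] 0‖) (n : ℕ) : 0 < dnorm l n 0 :=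
  lt_of_lt_of_le (by positivity) (pow_le_dnorm hA n)

/-- `pullSum` after an excursion near `0` followed by shadowing of the singular orbit. -/
lemma pullSum_shadow_le (hl : l ≠ 0) (hA : ∀ n, 200 ≤ ‖(expMap l)^[n + 1] 0‖) {n m : ℕ} {v : ℂ}
    (hx : ‖(expMap l)^[n] v‖ * dnorm l m 0 ≤ 1 / 8) :
    pullSum l (n + (m + 1)) v ≤ 4 / 3 * (pullSum l n v / dnorm l (m + 1) 0)
      + 8 / 3 / ‖(expMap l)^[m + 1] 0‖ := by
  set u := (expMap l)^[n] v with hu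
  have hux : ∀ j ≤ m, ‖u‖ * dnorm l j 0 ≤ 1 / 8 := fun j hj => by
    refine le_trans ?_ hx
    gcongr; exact dnorm_zero_le hA hj
  have key : ∀ j ≤ m, ‖(expMap l)^[j + 1] 0‖ * (3 / 4) ≤ ‖(expMap l)^[n + (j + 1)] v‖ := by
    intro j hj
    obtain ⟨-, -, h3, -⟩ := shadow hA hx hj
    rw [add_comm n, Function.iterate_add_apply _ (j + 1), ← hu]
    refine le_trans ?_ h3
    have := hux j hj
    gcongr
    linarith
  have h1 := pullSum_add_le hl n v (i := m) fun j hj => by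
    have := key j hj
    linarith [hA j]
  rw [← hu] at h1
  refine h1.trans ?_
  have hT := pullSum_nonneg (l := l) n v
  have hD := dnorm_zero_pos hA (m + 1)
  have hDu : dnorm l (m + 1) 0 * (3 / 4) ≤ dnorm l (m + 1) u := by
    obtain ⟨-, h3, -, -⟩ := shadow hA hx le_rfl
    refine le_trans ?_ h3
    gcongr; linarith
  have hZ := hA m
  have hZ0 : 0 < ‖(expMap l)^[m + 1] 0‖ := by linarith
  have e1 : pullSum l n v / dnorm l (m + 1) u ≤ 4 / 3 * (pullSum l n v / dnorm l (m + 1) 0) := by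
    calc pullSum l n v / dnorm l (m + 1) u ≤ pullSum l n v / (dnorm l (m + 1) 0 * (3 / 4)) := by
          gcongr
      _ = _ := by field_simp
  have e2 : 2 / ‖(expMap l)^[n + (m + 1)] v‖ ≤ 8 / 3 / ‖(expMap l)^[m + 1] 0‖ := by
    calc 2 / ‖(expMap l)^[n + (m + 1)] v‖ ≤ 2 / (‖(expMap l)^[m + 1] 0‖ * (3 / 4)) := by
          gcongr; exact key m le_rfl
      _ = _ := by field_simp; norm_num
  linarith

lemma pow_lt_exp {k : ℕ} {x y : ℝ} (hx : 0 ≤ x) (hy : k * x ≤ y) :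
    (x + 1) ^ k ≤ Real.exp y := by
  calc (x + 1) ^ k ≤ (Real.exp x) ^ k := by
        gcongr; exact Real.add_one_le_exp x
    _ = Real.exp (k * x) := (Real.exp_nat_mul x k).symm
    _ ≤ _ := Real.exp_le_exp.2 hy

lemma norm_ge_of_re (hX : ∀ n, 10 ^ 5 ≤ ((expMap l)^[n + 1] 0).re) (n : ℕ) :
    10 ^ 5 ≤ ‖(expMap l)^[n + 1] 0‖ :=
  (hX n).trans (re_le_norm _)

lemma norm_ge_of_re' (hX : ∀ n, 10 ^ 5 ≤ ((expMap l)^[n + 1] 0).re) (n : ℕ) :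
    200 ≤ ‖(expMap l)^[n + 1] 0‖ :=
  le_trans (by norm_num) (norm_ge_of_re hX n)

lemma pullSum_succ_le {n : ℕ} {v : ℂ} {a b : ℝ} (hb : 0 < b) (h1 : pullSum l n v + 1 ≤ a)
    (h2 : b ≤ ‖(expMap l)^[n + 1] v‖) : pullSum l (n + 1) v ≤ a / b := by
  have := pullSum_nonneg (l := l) n v
  rw [pullSum]
  gcongr
  linarith

lemma exists_good_succ (hl : Real.exp 200 ≤ ‖l‖) (hX : ∀ n, 10 ^ 5 ≤ ((expMap l)^[n + 1] 0).re)
    {z : ℂ} {n : ℕ} (hn : pullSum l n z ≤ 1 / 40) : ∃ k, n < k ∧ pullSum l k z ≤ 1 / 40 := by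
  have hl0 : l ≠ 0 := norm_pos_iff.1 ((Real.exp_pos _).trans_le hl)
  have hA := norm_ge_of_re' hX
  have hT := pullSum_nonneg (l := l) n z
  set u := (expMap l)^[n + 1] z with hu
  have hu0 : 0 < ‖u‖ := iterate_succ_norm_pos hl0 n z
  have he100 : (10 : ℝ) ^ 5 ≤ Real.exp 100 := by
    refine le_trans ?_ (pow_lt_exp (k := 4) (x := 25) (by norm_num) (by norm_num))
    norm_num
  have he200 : (10 : ℝ) ^ 5 ≤ Real.exp 200 := he100.trans (Real.exp_le_exp.2 (by norm_num))
  rcases le_or_gt 100 ‖u‖ with h | h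
  · refine ⟨n + 1, by omega, ?_⟩
    refine (pullSum_succ_le (a := 2) (b := 100) (by norm_num) (by linarith) h).trans (by norm_num)
  rcases le_or_gt (1 / 100) ‖u‖ with h' | h'
  · refine ⟨n + 2, by omega, ?_⟩
    have h1 : pullSum l (n + 1) z ≤ 2 / (1 / 100) :=
      pullSum_succ_le (by norm_num) (by linarith) h'
    refine (pullSum_succ_le (a := 201) (b := 10 ^ 5) (by norm_num) (by linarith) ?_).trans
      (by norm_num)
    rw [Function.iterate_succ_apply', norm_expMap, ← hu]
    have h2 : -100 ≤ u.re := by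
      have := (abs_le.1 (abs_re_le_norm u)).1
      linarith
    calc (10 : ℝ) ^ 5 ≤ Real.exp 100 := he100
      _ = Real.exp 200 * Real.exp (-100) := by rw [← Real.exp_add]; norm_num
      _ ≤ ‖l‖ * Real.exp u.re := by gcongr
  · obtain ⟨m, hm1, hm2⟩ := exists_scale hA hu0 h'
    have hx : ‖u‖ * dnorm l m 0 ≤ 1 / 8 := by linarith
    have h1 := pullSum_shadow_le hl0 hA (n := n + 1) (v := z) hx
    have h2 : pullSum l (n + 1) z ≤ 2 / ‖u‖ := pullSum_succ_le hu0 (by linarith) le_rfl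
    have hD := dnorm_zero_pos hA (m + 1)
    set s := ‖u‖ * dnorm l (m + 1) 0 with hs
    have hs0 : 0 < s := by linarith
    have h3 : pullSum l (n + 1) z / dnorm l (m + 1) 0 ≤ 2 / s := by
      calc _ ≤ 2 / ‖u‖ / dnorm l (m + 1) 0 := by gcongr
        _ = _ := by rw [hs, div_div]
    have hZ := norm_ge_of_re hX m
    have h4 : 8 / 3 / ‖(expMap l)^[m + 1] 0‖ ≤ 1 / 1000 := by
      calc 8 / 3 / ‖(expMap l)^[m + 1] 0‖ ≤ 8 / 3 / 10 ^ 5 := by gcongr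
        _ ≤ _ := by norm_num
    rcases le_or_gt 200 s with h5 | h5
    · refine ⟨n + 1 + (m + 1), by omega, ?_⟩
      have : 2 / s ≤ 2 / 200 := by gcongr
      linarith
    · refine ⟨n + 1 + (m + 1) + 1, by omega, ?_⟩
      have : 2 / s ≤ 2 / (1 / 100) := by gcongr
      refine (pullSum_succ_le (a := 300) (b := 10 ^ 5) (by norm_num) ?_ ?_).trans (by norm_num)
      · linarith
      · rw [Function.iterate_succ_apply', norm_expMap, add_comm (n + 1),
          Function.iterate_add_apply _ (m + 1), ← hu]
        obtain ⟨h6, -⟩ := shadow hA hx le_rfl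
        have h7 : 0 ≤ ((expMap l)^[m + 1] u).re := by
          have h8 := (abs_le.1 (abs_re_le_norm ((expMap l)^[m + 1] u - (expMap l)^[m + 1] 0))).1
          rw [sub_re] at h8
          have h9 := hX m
          have h10 : ‖(expMap l)^[m + 1] u - (expMap l)^[m + 1] 0‖ ≤ 300 := by
            refine h6.trans ?_
            rw [← hs]
            nlinarith
          linarith
        have := Real.one_le_exp h7
        nlinarith

lemma exists_good (hl : Real.exp 200 ≤ ‖l‖) (hX : ∀ n, 10 ^ 5 ≤ ((expMap l)^[n + 1] 0).re)
    (z : ℂ) (k : ℕ) :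
    ∃ n, 1 ≤ n ∧ pullSum l n z ≤ 1 / 40 ∧ (40 : ℝ) ^ k ≤ dnorm l n z := by
  have hl0 : l ≠ 0 := norm_pos_iff.1 ((Real.exp_pos _).trans_le hl)
  induction k with
  | zero =>
    obtain ⟨n, h1, h2⟩ := exists_good_succ hl hX (z := z) (n := 0) (by simp [pullSum])
    refine ⟨n, h1, h2, ?_⟩
    have h3 := dnorm_le_pullSum_mul hl0 z h1
    have := dnorm_pos hl0 n z
    rw [dnorm_zero] at h3
    rw [pow_zero]
    nlinarith
  | succ k ih =>
    obtain ⟨n, h1, h2, h3⟩ := ih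
    obtain ⟨p, h4, h5⟩ := exists_good_succ hl hX h2
    refine ⟨p, by omega, h5, ?_⟩
    have h6 := dnorm_le_pullSum_mul hl0 z h4
    have := dnorm_pos hl0 p z
    rw [pow_succ]
    nlinarith

/-- The open rectangle with the given real and imaginary bounds. -/
def rect (a b c d : ℝ) : Set ℂ := {w | (a < w.re ∧ w.re < b) ∧ c < w.im ∧ w.im < d}

lemma isOpen_rect (a b c d : ℝ) : IsOpen (rect a b c d) :=
  ((isOpen_lt continuous_const continuous_re).inter
    (isOpen_lt continuous_re continuous_const)).inter
    ((isOpen_lt continuous_const continuous_im).inter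
    (isOpen_lt continuous_im continuous_const))

lemma volume_rect (a b c d : ℝ) :
    volume (rect a b c d) = ENNReal.ofReal (b - a) * ENNReal.ofReal (d - c) := by
  have : rect a b c d = Complex.measurableEquivRealProd ⁻¹' (Ioo a b ×ˢ Ioo c d) := by
    ext w; simp [rect, Complex.measurableEquivRealProd]
  rw [this, Complex.volume_preserving_equiv_real_prod.measure_preimage
    (measurableSet_Ioo.prod measurableSet_Ioo).nullMeasurableSet, Measure.volume_eq_prod,
    Measure.prod_prod, Real.volume_Ioo, Real.volume_Ioo]

lemma volume_rect_ne_top (a b c d : ℝ) : volume (rect a b c d) ≠ ⊤ := by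
  rw [volume_rect]; exact ENNReal.mul_ne_top ENNReal.ofReal_ne_top ENNReal.ofReal_ne_top

lemma volume_real_rect {a b c d : ℝ} (h1 : a ≤ b) (h2 : c ≤ d) :
    volume.real (rect a b c d) = (b - a) * (d - c) := by
  rw [measureReal_def, volume_rect, ENNReal.toReal_mul, ENNReal.toReal_ofReal (by linarith),
    ENNReal.toReal_ofReal (by linarith)]

/-- The cell with lower left corner `z`. -/
def cell (z : ℂ) : Set ℂ := rect z.re (z.re + 1) z.im (z.im + 2 * Real.pi)

lemma isOpen_cell (z : ℂ) : IsOpen (cell z) := isOpen_rect _ _ _ _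

lemma volume_cell_ne_top (z : ℂ) : volume (cell z) ≠ ⊤ := volume_rect_ne_top _ _ _ _

lemma volume_real_cell (z : ℂ) : volume.real (cell z) = 2 * Real.pi := by
  rw [cell, volume_real_rect (by linarith) (by linarith [Real.pi_pos])]; ring

/-- The density of `E` in the cell with corner `z`. -/
noncomputable def dens (E : Set ℂ) (z : ℂ) : ℝ := volume.real (E ∩ cell z) / (2 * Real.pi)

lemma two_pi_mul_dens (E : Set ℂ) (z : ℂ) :
    2 * Real.pi * dens E z = volume.real (E ∩ cell z) := by
  have := Real.pi_pos
  rw [dens]; field_simp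

lemma dens_nonneg (E : Set ℂ) (z : ℂ) : 0 ≤ dens E z :=
  div_nonneg measureReal_nonneg (by linarith [Real.pi_pos])

lemma translate_volume (C E : Set ℂ) (z : ℂ) :
    volume {c | c ∈ C ∧ z + c ∈ E} = volume (E ∩ (fun c => z + c) '' C) := by
  rw [← measure_preimage_add volume z (E ∩ (fun c => z + c) '' C)]
  congr 1
  ext c
  simp [and_comm]

lemma image_cell (z : ℂ) : (fun c => z + c) '' cell 0 = cell z := by
  ext w
  simp only [cell, rect, mem_image, mem_ofPred_eq, zero_re, zero_im]
  constructor
  · rintro ⟨c, ⟨⟨h1, h2⟩, h3, h4⟩, rfl⟩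
    simp only [add_re, add_im]
    refine ⟨⟨?_, ?_⟩, ?_, ?_⟩ <;> linarith
  · rintro ⟨⟨h1, h2⟩, h3, h4⟩
    refine ⟨w - z, ⟨⟨?_, ?_⟩, ?_, ?_⟩, by ring⟩ <;> simp only [sub_re, sub_im] <;> linarith

lemma volume_cell_inter (E : Set ℂ) (z : ℂ) :
    volume {c | c ∈ cell 0 ∧ z + c ∈ E} = volume (E ∩ cell z) := by
  rw [translate_volume, image_cell]

lemma image_ball (z : ℂ) (σ : ℝ) : (fun c => z + c) '' ball 0 σ = ball z σ := by
  simp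

lemma norm_le_of_mem_cell {c : ℂ} (hc : c ∈ cell 0) : ‖c‖ ≤ 8 := by
  obtain ⟨⟨h1, h2⟩, h3, h4⟩ := hc
  simp only [zero_re, zero_im, zero_add] at h1 h2 h3 h4
  refine (norm_le_abs_re_add_abs_im c).trans ?_
  rw [abs_of_pos h1, abs_of_pos h3]
  linarith [Real.pi_lt_d2]

lemma volume_real_ball (z : ℂ) {r : ℝ} (hr : 0 ≤ r) :
    volume.real (ball z r) = r ^ 2 * Real.pi := by
  rw [measureReal_def, Complex.volume_ball]
  simp [hr]

lemma expMap_inj_of_im {v w : ℂ} (hl : l ≠ 0) (h : expMap l v = expMap l w)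
    (him : |v.im - w.im| < 2 * Real.pi) : v = w := by
  have h1 : exp v = exp w := mul_left_cancel₀ hl h
  obtain ⟨n, hn⟩ := Complex.exp_eq_exp_iff_exists_int.1 h1
  have h2 : v.im - w.im = n * (2 * Real.pi) := by
    rw [hn]; simp
  have hpi := Real.pi_pos
  rw [h2, abs_mul, abs_of_pos (by linarith : 0 < 2 * Real.pi)] at him
  have h3 : |(n : ℝ)| < 1 := by
    by_contra hc
    push Not at hc
    nlinarith
  have h4 : n = 0 := by
    have : |n| < 1 := by exact_mod_cast h3
    exact Int.abs_lt_one_iff.1 this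
  rw [hn, h4]; simp

lemma injOn_cell (hl : l ≠ 0) (z : ℂ) : InjOn (expMap l) (cell z) := by
  intro v hv w hw h
  obtain ⟨-, h3, h4⟩ := hv
  obtain ⟨-, h5, h6⟩ := hw
  exact expMap_inj_of_im hl h (abs_lt.2 ⟨by linarith, by linarith⟩)

lemma closedBall_subset_rect {a b c d ε : ℝ} {v : ℂ}
    (hv : v ∈ rect (a + ε) (b - ε) (c + ε) (d - ε)) : closedBall v ε ⊆ rect a b c d := by
  intro w hw
  rw [mem_closedBall, dist_eq_norm] at hw
  obtain ⟨⟨h1, h2⟩, h3, h4⟩ := hv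
  have h5 := abs_le.1 ((abs_re_le_norm (w - v)).trans hw)
  have h6 := abs_le.1 ((abs_im_le_norm (w - v)).trans hw)
  rw [sub_re] at h5
  rw [sub_im] at h6
  exact ⟨⟨by linarith, by linarith⟩, by linarith, by linarith⟩

/-- The cell with corner `z`, shrunk by `ε`. -/
def innerCell (z : ℂ) (ε : ℝ) : Set ℂ :=
  rect (z.re + ε) (z.re + 1 - ε) (z.im + ε) (z.im + 2 * Real.pi - ε)

lemma innerCell_subset (z : ℂ) {ε : ℝ} (hε : 0 ≤ ε) : innerCell z ε ⊆ cell z :=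
  fun _ h => ⟨⟨by linarith [h.1.1], by linarith [h.1.2]⟩, by linarith [h.2.1],
    by linarith [h.2.2]⟩

lemma le_volume_innerCell (z : ℂ) {ε : ℝ} (hε : 0 ≤ ε) (hε' : ε ≤ 1 / 4) :
    2 * Real.pi * (1 - 3 * ε) ≤ volume.real (innerCell z ε) := by
  have := Real.pi_gt_three
  rw [innerCell, volume_real_rect (by linarith) (by linarith)]
  nlinarith

lemma norm_expMap_mem_cell {z v : ℂ} (hv : v ∈ cell z) :
    ‖l‖ * Real.exp z.re ≤ ‖expMap l v‖ ∧ ‖expMap l v‖ ≤ ‖l‖ * Real.exp (z.re + 1) := by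
  rw [norm_expMap]
  obtain ⟨⟨h1, h2⟩, -⟩ := hv
  constructor <;> gcongr

lemma pullSum_one (v : ℂ) : pullSum l 1 v = 1 / ‖expMap l v‖ := by
  simp [pullSum]

/-- Transport of density through cells. -/
lemma dens_push_cell (hl : l ≠ 0) {E : Set ℂ} (hE : MeasurableSet E)
    (hinv : expMap l ⁻¹' E = E) {n : ℕ} (hn : 1 ≤ n) {G0 G : Set ℂ} (hG0 : IsOpen G0)
    (hG0f : volume G0 ≠ ⊤) (hinj : InjOn ((expMap l)^[n]) G0) (hG : MeasurableSet G)
    {τ : ℝ} (hτ0 : 0 ≤ τ) (hτ : τ ≤ 1 / 2)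
    (hT : ∀ v ∈ G, 8 * pullSum l n v ≤ τ) (hball : ∀ v ∈ G, closedBall v (2 * τ) ⊆ G0)
    {η : ℝ} (hη0 : 0 ≤ η) (hη : ∀ v ∈ G, η ≤ dens E ((expMap l)^[n] v)) :
    (1 - τ) ^ 2 * (η * volume.real G) ≤ volume.real (E ∩ G0) := by
  have hpi := Real.pi_pos
  have hc := volume_real_cell 0
  refine mul_volume_le hl hE hinv hn hG0 hG0f hinj hG (isOpen_cell 0).measurableSet ?_
    (volume_cell_ne_top 0) hτ0 hτ (fun c hc => norm_le_of_mem_cell hc) hT hball hη0 ?_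
  · intro h
    rw [measureReal_def, h] at hc
    simp at hc
  · intro v hv
    have h1 := volume_cell_inter E ((expMap l)^[n] v)
    rw [hc, measureReal_def, h1, ← measureReal_def, ← two_pi_mul_dens, mul_comm]
    have := hη v hv
    gcongr

/-- Transport of density through discs. -/
lemma dens_push_ball (hl : l ≠ 0) {E : Set ℂ} (hE : MeasurableSet E)
    (hinv : expMap l ⁻¹' E = E) {n : ℕ} (hn : 1 ≤ n) {G0 G : Set ℂ} (hG0 : IsOpen G0)
    (hG0f : volume G0 ≠ ⊤) (hinj : InjOn ((expMap l)^[n]) G0) (hG : MeasurableSet G)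
    {τ σ : ℝ} (hσ : 0 < σ) (hτ0 : 0 ≤ τ) (hτ : τ ≤ 1 / 2)
    (hT : ∀ v ∈ G, σ * pullSum l n v ≤ τ) (hball : ∀ v ∈ G, closedBall v (2 * τ) ⊆ G0)
    {η : ℝ} (hη0 : 0 ≤ η) (hη : ∀ v ∈ G, η * (σ ^ 2 * Real.pi) ≤
      volume.real (E ∩ ball ((expMap l)^[n] v) σ)) :
    (1 - τ) ^ 2 * (η * volume.real G) ≤ volume.real (E ∩ G0) := by
  refine mul_volume_le hl hE hinv hn hG0 hG0f hinj hG (C := ball 0 σ) measurableSet_ball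
    (measure_ball_pos _ _ hσ).ne' measure_ball_lt_top.ne hτ0 hτ (h := σ) ?_ hT hball hη0 ?_
  · intro c hc
    exact (mem_ball_zero_iff.1 hc).le
  · intro v hv
    rw [volume_real_ball _ hσ.le, measureReal_def, translate_volume, image_ball]
    exact hη v hv

/-- The iterates up to one step after leaving the neighbourhood of `0` are injective on a disc. -/
lemma iterate_injective_near_zero (hl : l ≠ 0) (hA : ∀ n, 200 ≤ ‖(expMap l)^[n + 1] 0‖) {m : ℕ}
    {u w : ℂ} (hu : ‖u‖ * dnorm l m 0 ≤ 1 / 8) (hw : ‖w‖ * dnorm l m 0 ≤ 1 / 8)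
    (h : (expMap l)^[m + 1] u = (expMap l)^[m + 1] w) : u = w := by
  suffices H : ∀ i, i ≤ m + 1 → (expMap l)^[i] u = (expMap l)^[i] w → u = w from
    H (m + 1) le_rfl h
  intro i
  induction i with
  | zero => intro _ h; exact h
  | succ i ih =>
    intro hi h
    refine ih (by omega) ?_
    rw [Function.iterate_succ_apply', Function.iterate_succ_apply'] at h
    refine expMap_inj_of_im hl h ?_
    have aux : ∀ u : ℂ, ‖u‖ * dnorm l m 0 ≤ 1 / 8 →
        ‖(expMap l)^[i] u - (expMap l)^[i] 0‖ ≤ 1 := by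
      intro u hu
      have h1 : ‖u‖ * dnorm l i 0 ≤ 1 / 8 := by
        refine le_trans ?_ hu
        gcongr; exact dnorm_zero_le hA (by omega)
      have h0 : 0 ≤ ‖u‖ * dnorm l i 0 := mul_nonneg (norm_nonneg _) (dnorm_pos hl _ _).le
      refine (norm_iterate_sub_le_and_le_dnorm hA i h1).1.trans ?_
      nlinarith
    have h2 : ‖(expMap l)^[i] u - (expMap l)^[i] w‖ ≤ 2 := by
      calc _ = ‖((expMap l)^[i] u - (expMap l)^[i] 0) - ((expMap l)^[i] w - (expMap l)^[i] 0)‖ := by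
            congr 1; ring
        _ ≤ _ := norm_sub_le _ _
        _ ≤ 1 + 1 := add_le_add (aux u hu) (aux w hw)
        _ = 2 := by norm_num
    rw [← sub_im]
    have := abs_im_le_norm ((expMap l)^[i] u - (expMap l)^[i] w)
    linarith [Real.pi_gt_three]

/-- Density in small discs near a point of the singular orbit. -/
lemma dens_near_orbit (hl : l ≠ 0) {E : Set ℂ} (hE : MeasurableSet E)
    (hinv : expMap l ⁻¹' E = E) {m : ℕ} {ε η B : ℝ} (hε : 0 < ε) (hε' : ε ≤ 1 / 4) (hη0 : 0 ≤ η)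
    (h2 : Real.exp (1000 / ε) ≤ ‖(expMap l)^[m + 2] 0‖)
    (hB2 : ‖(expMap l)^[m + 2] 0‖ ≤ B)
    (hη : ∀ ζ : ℂ, |ζ.re| ≤ Real.exp (1000 / ε) * B → η ≤ dens E ζ) {ζ : ℂ}
    (hζ : ‖ζ - (expMap l)^[m + 1] 0‖ ≤ 384 / ε) :
    (1 - 2 * ε) * η * ((ε / 500) ^ 2 * Real.pi) ≤ volume.real (E ∩ ball ζ (ε / 500)) := by
  set Z := (expMap l)^[m + 1] 0 with hZ
  set σ := ε / 500 with hσ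
  have hσ0 : 0 < σ := by positivity
  have hεi : 4 ≤ 1 / ε := by rw [le_div_iff₀ hε]; linarith
  have e1 : 1000 / ε = 1000 * (1 / ε) := by ring
  have e2 : 384 / ε = 384 * (1 / ε) := by ring
  have hfZ : ‖(expMap l)^[m + 2] 0‖ = ‖l‖ * Real.exp Z.re := by
    rw [Function.iterate_succ_apply', norm_expMap]
  have hre : ∀ v ∈ ball ζ σ, |v.re - Z.re| ≤ 384 / ε + 1 := by
    intro v hv
    rw [← sub_re]
    refine (abs_re_le_norm _).trans ?_
    have h3 : ‖v - ζ‖ < σ := by rw [← dist_eq_norm]; exact hv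
    calc ‖v - Z‖ = ‖(v - ζ) + (ζ - Z)‖ := by congr 1; ring
      _ ≤ ‖v - ζ‖ + ‖ζ - Z‖ := norm_add_le _ _
      _ ≤ _ := by
        have : σ ≤ 1 := by rw [hσ]; linarith
        linarith
  have hlow : ∀ v ∈ ball ζ σ, 90000 / ε ^ 2 ≤ ‖expMap l v‖ := by
    intro v hv
    have h3 := (abs_le.1 (hre v hv)).1
    have h4 : (300 * (1 / ε) + 1) ^ 2 ≤ Real.exp (600 * (1 / ε)) := by
      refine pow_lt_exp (by positivity) ?_
      push_cast; linarith
    calc 90000 / ε ^ 2 = (300 * (1 / ε)) ^ 2 := by field_simp; norm_num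
      _ ≤ (300 * (1 / ε) + 1) ^ 2 := by gcongr; linarith
      _ ≤ Real.exp (600 * (1 / ε)) := h4
      _ ≤ Real.exp (1000 / ε - 384 / ε - 1) := by
        apply Real.exp_le_exp.2; linarith
      _ = Real.exp (1000 / ε) * Real.exp (- 384 / ε - 1) := by
        rw [← Real.exp_add]; congr 1; ring
      _ ≤ (‖l‖ * Real.exp Z.re) * Real.exp (- 384 / ε - 1) := by
        rw [← hfZ]; gcongr
      _ = ‖l‖ * Real.exp (Z.re - (384 / ε + 1)) := by
        rw [mul_assoc, ← Real.exp_add]; congr 2; ring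
      _ ≤ ‖expMap l v‖ := by
        rw [norm_expMap]; gcongr; linarith
  have hhigh : ∀ v ∈ ball ζ σ, ‖expMap l v‖ ≤ Real.exp (1000 / ε) * B := by
    intro v hv
    have h3 := (abs_le.1 (hre v hv)).2
    calc ‖expMap l v‖ = ‖l‖ * Real.exp v.re := norm_expMap v
      _ ≤ ‖l‖ * Real.exp (Z.re + 1000 / ε) := by gcongr; linarith
      _ = (‖l‖ * Real.exp Z.re) * Real.exp (1000 / ε) := by rw [Real.exp_add]; ring
      _ ≤ B * Real.exp (1000 / ε) := by gcongr; rw [← hfZ]; exact hB2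
      _ = _ := mul_comm _ _
  have hsub : ball ζ (σ * (1 - ε / 5)) ⊆ ball ζ σ := ball_subset_ball (by nlinarith)
  have h5 := dens_push_cell hl hE hinv (n := 1) le_rfl (G0 := ball ζ σ)
    (G := ball ζ (σ * (1 - ε / 5))) isOpen_ball measure_ball_lt_top.ne ?_ measurableSet_ball
    (τ := σ * ε / 20) (by positivity) ?_ ?_ ?_ hη0 ?_
  · rw [volume_real_ball _ (by apply mul_nonneg hσ0.le; linarith)] at h5
    refine le_trans ?_ h5
    have h6 : 1 - ε / 5 ≤ 1 - σ * ε / 20 := by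
      rw [hσ]; nlinarith
    have h7 : 1 - 2 * ε ≤ (1 - ε / 5) ^ 2 * (1 - ε / 5) ^ 2 := by nlinarith [sq_nonneg ε]
    have h8 : 0 ≤ 1 - ε / 5 := by linarith
    calc (1 - 2 * ε) * η * (σ ^ 2 * Real.pi)
        ≤ ((1 - ε / 5) ^ 2 * (1 - ε / 5) ^ 2) * η * (σ ^ 2 * Real.pi) := by
          have := Real.pi_pos
          gcongr
      _ = (1 - ε / 5) ^ 2 * (η * ((σ * (1 - ε / 5)) ^ 2 * Real.pi)) := by ring
      _ ≤ _ := by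
          have := Real.pi_pos
          gcongr
  · intro v hv w hw h
    refine expMap_inj_of_im hl h ?_
    rw [← sub_im]
    refine (abs_im_le_norm _).trans_lt ?_
    have h6 : dist v w < σ + σ := (dist_triangle_right v w ζ).trans_lt (add_lt_add hv hw)
    rw [dist_eq_norm] at h6
    have : σ ≤ 1 := by rw [hσ]; linarith
    linarith [Real.pi_gt_three]
  · rw [hσ]; nlinarith
  · intro v hv
    rw [pullSum_one]
    have h6 := hlow v (hsub hv)
    have h7 : 1 / ‖expMap l v‖ ≤ 1 / (90000 / ε ^ 2) := by gcongr
    have h8 : 1 / (90000 / ε ^ 2) = ε ^ 2 / 90000 := by field_simp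
    rw [hσ]
    rw [h8] at h7
    nlinarith
  · intro v hv
    refine (closedBall_subset_ball' ?_)
    have : dist v ζ < σ * (1 - ε / 5) := hv
    nlinarith
  · intro v hv
    refine hη _ ((abs_re_le_norm _).trans (hhigh v (hsub hv)))

/-- Lower density bounds propagate to the far left. -/
lemma dens_left (hl : l ≠ 0) (hA : ∀ n, 200 ≤ ‖(expMap l)^[n + 1] 0‖) {E : Set ℂ}
    (hE : MeasurableSet E) (hinv : expMap l ⁻¹' E = E) {m : ℕ} {ε η B : ℝ} (hε : 0 < ε)
    (hε' : ε ≤ 1 / 4) (hη0 : 0 ≤ η) {z : ℂ}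
    (hm1 : ‖l‖ * Real.exp z.re * dnorm l m 0 < 1 / 100)
    (hm2 : 1 / 100 ≤ ‖l‖ * Real.exp z.re * dnorm l (m + 1) 0)
    (h1 : Real.exp (1000 / ε) ≤ ‖(expMap l)^[m + 1] 0‖)
    (h2 : Real.exp (1000 / ε) ≤ ‖(expMap l)^[m + 2] 0‖)
    (hB1 : ‖(expMap l)^[m + 1] 0‖ ≤ B) (hB2 : ‖(expMap l)^[m + 2] 0‖ ≤ B)
    (hη : ∀ ζ : ℂ, |ζ.re| ≤ Real.exp (1000 / ε) * B → η ≤ dens E ζ) :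
    (1 - 10 * ε) * η ≤ dens E z := by
  set ρ := ‖l‖ * Real.exp z.re with hρ
  have hρ0 : 0 < ρ := mul_pos (norm_pos_iff.2 hl) (Real.exp_pos _)
  set s := ρ * dnorm l (m + 1) 0 with hs
  have hs0 : 0 < s := by linarith
  have hεi : 4 ≤ 1 / ε := by rw [le_div_iff₀ hε]; linarith
  have e1 : 1000 / ε = 1000 * (1 / ε) := by ring
  have hZe : 1000 / ε ≤ ‖(expMap l)^[m + 1] 0‖ := by
    have := Real.add_one_le_exp (1000 / ε)
    linarith
  have hρu : ∀ v ∈ cell z, ρ ≤ ‖expMap l v‖ ∧ ‖expMap l v‖ ≤ 2.72 * ρ := by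
    intro v hv
    obtain ⟨h3, h4⟩ := norm_expMap_mem_cell (l := l) hv
    refine ⟨h3, h4.trans ?_⟩
    rw [Real.exp_add, ← mul_assoc, mul_comm 2.72]
    gcongr
    exact Real.exp_one_lt_d9.le.trans (by norm_num)
  have hDm := dnorm_pos hl m 0
  have hDm1 := dnorm_pos hl (m + 1) 0
  have hxm : ∀ v ∈ cell z, ‖expMap l v‖ * dnorm l m 0 ≤ 0.03 := by
    intro v hv
    calc ‖expMap l v‖ * dnorm l m 0 ≤ 2.72 * ρ * dnorm l m 0 := by
          gcongr; exact (hρu v hv).2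
      _ ≤ 0.03 := by linarith
  have hinj : InjOn ((expMap l)^[1 + (m + 1)]) (cell z) := by
    intro v hv w hw h
    rw [add_comm 1 (m + 1), Function.iterate_succ_apply, Function.iterate_succ_apply] at h
    refine injOn_cell hl z hv hw ?_
    exact iterate_injective_near_zero hl hA (by linarith [hxm v hv]) (by linarith [hxm w hw]) h
  have hT : ∀ v ∈ cell z, pullSum l (1 + (m + 1)) v ≤ 4 / 3 * (1 / s) + ε / 300 := by
    intro v hv
    have h3 := pullSum_shadow_le hl hA (n := 1) (m := m) (v := v)
      (by have := hxm v hv; simp only [Function.iterate_one]; linarith)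
    refine h3.trans ?_
    have h4 : pullSum l 1 v / dnorm l (m + 1) 0 ≤ 1 / s := by
      rw [pullSum_one, hs]
      calc _ ≤ 1 / ρ / dnorm l (m + 1) 0 := by
            gcongr; exact (hρu v hv).1
        _ = _ := by rw [div_div]
    have h5 : 8 / 3 / ‖(expMap l)^[m + 1] 0‖ ≤ ε / 300 := by
      calc 8 / 3 / ‖(expMap l)^[m + 1] 0‖ ≤ 8 / 3 / (1000 / ε) := by gcongr
        _ = ε / 375 := by field_simp; norm_num
        _ ≤ _ := by linarith
    linarith
  have hG := innerCell_subset z hε.le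
  have hball : ∀ v ∈ innerCell z ε, closedBall v (2 * (ε / 2)) ⊆ cell z := by
    intro v hv
    rw [mul_div_cancel₀ _ (two_ne_zero)]
    refine closedBall_subset_rect ?_
    simpa [innerCell] using hv
  have hpi := Real.pi_pos
  have hfin : ∀ c : ℝ, 0 ≤ c → (1 - ε / 2) ^ 2 * (c * volume.real (innerCell z ε)) ≤
      volume.real (E ∩ cell z) → (1 - ε) * (1 - 3 * ε) * c ≤ dens E z := by
    intro c hc h3
    rw [← two_pi_mul_dens] at h3
    have h4 := le_volume_innerCell z hε.le hε'
    have h5 : 1 - ε ≤ (1 - ε / 2) ^ 2 := by nlinarith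
    have h6 : 2 * Real.pi * ((1 - ε) * (1 - 3 * ε) * c) ≤ 2 * Real.pi * dens E z := by
      calc 2 * Real.pi * ((1 - ε) * (1 - 3 * ε) * c)
          = (1 - ε) * (c * (2 * Real.pi * (1 - 3 * ε))) := by ring
        _ ≤ (1 - ε / 2) ^ 2 * (c * volume.real (innerCell z ε)) := by
            have : 0 ≤ 1 - 3 * ε := by linarith
            gcongr
        _ ≤ _ := h3
    exact le_of_mul_le_mul_left h6 (by linarith)
  have happ : ∀ v : ℂ, (expMap l)^[1 + (m + 1)] v = (expMap l)^[m + 1] (expMap l v) := by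
    intro v
    rw [add_comm 1 (m + 1), Function.iterate_succ_apply]
  rcases le_or_gt (64 / ε) s with hs64 | hs64
  · refine le_trans ?_ (hfin η hη0 (dens_push_cell hl hE hinv (by omega) (isOpen_cell z)
      (volume_cell_ne_top z) hinj (isOpen_rect _ _ _ _).measurableSet (by linarith) (by linarith)
      ?_ hball hη0 ?_))
    · have : 1 - 10 * ε ≤ (1 - ε) * (1 - 3 * ε) := by nlinarith
      gcongr
    · intro v hv
      have h3 := hT v (hG hv)
      have h4 : 1 / s ≤ 1 / (64 / ε) := by gcongr
      rw [one_div_div] at h4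
      linarith
    · intro v hv
      refine hη _ ?_
      have h3 := hxm v (hG hv)
      obtain ⟨-, -, -, h4⟩ := shadow hA (u := expMap l v) (m := m) (by linarith) le_rfl
      rw [happ]
      refine (abs_re_le_norm _).trans (h4.trans ?_)
      have h5 := Real.add_one_le_exp (1000 / ε)
      have h6 : 2 ≤ Real.exp (1000 / ε) := by linarith
      calc _ ≤ ‖(expMap l)^[m + 1] 0‖ * 2 := by gcongr; linarith
        _ ≤ B * Real.exp (1000 / ε) := by gcongr; exact (norm_nonneg _).trans hB1
        _ = _ := mul_comm _ _
  · have hη' : 0 ≤ (1 - 2 * ε) * η := mul_nonneg (by linarith) hη0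
    refine le_trans ?_ (hfin ((1 - 2 * ε) * η) hη' (dens_push_ball hl hE hinv (by omega)
      (isOpen_cell z) (volume_cell_ne_top z) hinj (isOpen_rect _ _ _ _).measurableSet
      (σ := ε / 500) (by positivity) (by linarith) (by linarith)
      ?_ hball hη' ?_))
    · have : 1 - 10 * ε ≤ (1 - ε) * (1 - 3 * ε) * (1 - 2 * ε) := by nlinarith [sq_nonneg ε]
      calc (1 - 10 * ε) * η ≤ ((1 - ε) * (1 - 3 * ε) * (1 - 2 * ε)) * η := by gcongr
        _ = _ := by ring
    · intro v hv
      have h3 := hT v (hG hv)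
      have h4 : 1 / s ≤ 1 / (1 / 100) := by gcongr
      norm_num at h4
      rw [div_mul_eq_mul_div, div_le_iff₀ (by norm_num)]
      have h5 : pullSum l (1 + (m + 1)) v ≤ 201 := by norm_num at h3 ⊢; linarith
      nlinarith
    · intro v hv
      refine dens_near_orbit hl hE hinv (m := m) hε hε' hη0 h2 hB2 hη ?_
      have h3 := hxm v (hG hv)
      obtain ⟨h4, -, -, -⟩ := shadow hA (u := expMap l v) (m := m) (by linarith) le_rfl
      rw [happ]
      refine h4.trans ?_
      have h5 : ‖expMap l v‖ * dnorm l (m + 1) 0 ≤ 2.72 * (64 / ε) := by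
        calc ‖expMap l v‖ * dnorm l (m + 1) 0 ≤ 2.72 * ρ * dnorm l (m + 1) 0 := by
              gcongr; exact (hρu v (hG hv)).2
          _ = 2.72 * s := by rw [hs]; ring
          _ ≤ _ := by gcongr
      calc _ ≤ 2.72 * (64 / ε) * 2 := by
            gcongr
            linarith
        _ = 2.72 * 2 * 64 * (1 / ε) := by ring
        _ ≤ 384 * (1 / ε) := by gcongr; norm_num
        _ = _ := by ring

/-- Lower density bounds propagate to the right. -/
lemma dens_right (hl : l ≠ 0) {E : Set ℂ} (hE : MeasurableSet E) (hinv : expMap l ⁻¹' E = E)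
    {ε c : ℝ} (hε : 0 < ε) (hε' : ε ≤ 1 / 4) (hc : 0 ≤ c) {z : ℂ}
    (hz : 16 / ε ≤ ‖l‖ * Real.exp z.re)
    (h : ∀ ζ : ℂ, ‖ζ‖ ≤ ‖l‖ * Real.exp (z.re + 1) → 2 * c ≤ dens E ζ + dens E (-ζ)) :
    (1 - 10 * ε) * c ≤ dens E z := by
  have hpi := Real.pi_pos
  have hpi3 := Real.pi_gt_three
  set a : ℂ := Real.pi * I with ha
  have hare : a.re = 0 := by simp [ha]
  have haim : a.im = Real.pi := by simp [ha]
  set G1 : Set ℂ := rect (z.re + ε) (z.re + 1 - ε) (z.im + ε) (z.im + Real.pi - ε) with hG1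
  set G2 : Set ℂ := (fun v => v + a) '' G1 with hG2
  have hG1m : MeasurableSet G1 := (isOpen_rect _ _ _ _).measurableSet
  have hemb : MeasurableEmbedding (fun v : ℂ => v + a) := measurableEmbedding_addRight a
  have hG2m : MeasurableSet G2 := hemb.measurableSet_image.2 hG1m
  have hG1s : G1 ⊆ innerCell z ε := fun v hv =>
    ⟨hv.1, hv.2.1, by linarith [hv.2.2]⟩
  have hG2s : G2 ⊆ innerCell z ε := by
    rintro _ ⟨v, ⟨⟨h1, h2⟩, h3, h4⟩, rfl⟩
    refine ⟨⟨?_, ?_⟩, ?_, ?_⟩ <;> simp only [add_re, add_im, hare, haim] <;> linarith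
  have hdisj : Disjoint G1 G2 := by
    rw [Set.disjoint_left]
    rintro _ h1 ⟨v, h2, rfl⟩
    have h3 := h1.2.2
    have h4 := h2.2.1
    simp only [add_im, haim] at h3
    linarith
  have hG : G1 ∪ G2 ⊆ innerCell z ε := union_subset hG1s hG2s
  set q : ℂ → ENNReal := fun ζ => volume {c | c ∈ cell 0 ∧ ζ + c ∈ E} with hq
  have hneg : ∀ v, expMap l (v + a) = - expMap l v := by
    intro v
    rw [expMap, ha, exp_add, exp_pi_mul_I, expMap]; ring
  have hsum : ∀ v ∈ G1, ENNReal.ofReal (2 * Real.pi * (2 * c)) ≤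
      q (expMap l v) + q (expMap l (v + a)) := by
    intro v hv
    have h1 : ∀ ζ, q ζ = ENNReal.ofReal (2 * Real.pi * dens E ζ) := by
      intro ζ
      rw [two_pi_mul_dens, measureReal_def, ENNReal.ofReal_toReal
        (ne_top_of_le_ne_top (volume_cell_ne_top ζ) (measure_mono inter_subset_right)), hq]
      exact volume_cell_inter E ζ
    rw [hneg, h1, h1, ← ENNReal.ofReal_add (mul_nonneg (by linarith) (dens_nonneg _ _))
      (mul_nonneg (by linarith) (dens_nonneg _ _)), ← mul_add]
    apply ENNReal.ofReal_le_ofReal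
    have := h (expMap l v) (norm_expMap_mem_cell (innerCell_subset z hε.le (hG1s hv))).2
    gcongr
  have hint : ENNReal.ofReal (2 * Real.pi * (2 * c)) * volume G1 ≤
      ∫⁻ v in G1 ∪ G2, q (expMap l v) := by
    have h2 : ∫⁻ v in G2, q (expMap l v) = ∫⁻ v in G1, q (expMap l (v + a)) :=
      ((measurePreserving_add_right volume a).setLIntegral_comp_emb hemb
        (fun v => q (expMap l v)) G1).symm
    rw [lintegral_union hG2m hdisj, h2, ← setLIntegral_const]
    refine (setLIntegral_mono' hG1m hsum).trans (le_of_eq ?_)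
    refine lintegral_add_left ?_ _
    have : Measurable q := by
      have hS : MeasurableSet {p : ℂ × ℂ | p.2 ∈ cell 0 ∧ p.1 + p.2 ∈ E} :=
        (measurable_snd (isOpen_cell 0).measurableSet).inter
          ((measurable_fst.add measurable_snd) hE)
      exact measurable_measure_prodMk_left hS
    exact this.comp (continuous_iterate 1).measurable
  have hpush := lintegral_cell_le hl hE hinv (n := 1) le_rfl (G0 := cell z) (G := G1 ∪ G2)
    (C := cell 0) (isOpen_cell z) (injOn_cell hl z) (hG1m.union hG2m)
    (isOpen_cell 0).measurableSet (τ := ε / 2) (h := 8) (by linarith)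
    (fun c hc => norm_le_of_mem_cell hc) ?_ ?_
  · have h3 := (mul_le_mul_right hint (ENNReal.ofReal ((1 - ε / 2) ^ 2))).trans hpush
    have h4 : volume (E ∩ cell z) ≠ ⊤ :=
      ne_top_of_le_ne_top (volume_cell_ne_top z) (measure_mono inter_subset_right)
    have h5 := ENNReal.toReal_mono (ENNReal.mul_ne_top h4 (volume_cell_ne_top 0)) h3
    rw [ENNReal.toReal_mul, ENNReal.toReal_mul, ENNReal.toReal_mul,
      ENNReal.toReal_ofReal (by positivity), ENNReal.toReal_ofReal (by positivity),
      ← measureReal_def, ← measureReal_def, ← measureReal_def, volume_real_cell,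
      ← two_pi_mul_dens, hG1, volume_real_rect (by linarith) (by linarith)] at h5
    have h6 : Real.pi * (1 - 3 * ε) ≤
        (z.re + 1 - ε - (z.re + ε)) * (z.im + Real.pi - ε - (z.im + ε)) := by
      nlinarith
    have h7 : 1 - 10 * ε ≤ (1 - ε / 2) ^ 2 * (1 - 3 * ε) := by
      have h9 : 1 - ε ≤ (1 - ε / 2) ^ 2 := by nlinarith
      have h10 : (1 - ε) * (1 - 3 * ε) ≤ (1 - ε / 2) ^ 2 * (1 - 3 * ε) :=
        mul_le_mul_of_nonneg_right h9 (by linarith)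
      nlinarith
    have h8 : (2 * Real.pi * (2 * Real.pi)) * ((1 - 10 * ε) * c) ≤
        (2 * Real.pi * (2 * Real.pi)) * dens E z := by
      calc (2 * Real.pi * (2 * Real.pi)) * ((1 - 10 * ε) * c)
          ≤ (2 * Real.pi * (2 * Real.pi)) * (((1 - ε / 2) ^ 2 * (1 - 3 * ε)) * c) := by gcongr
        _ = (1 - ε / 2) ^ 2 * (2 * Real.pi * (2 * c) * (Real.pi * (1 - 3 * ε))) := by ring
        _ ≤ _ := (mul_le_mul_of_nonneg_left (mul_le_mul_of_nonneg_left h6 (by positivity))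
            (by positivity)).trans h5
        _ = _ := by ring
    exact le_of_mul_le_mul_left h8 (by positivity)
  · intro v hv
    rw [pullSum_one]
    have h3 := (norm_expMap_mem_cell (l := l) (innerCell_subset z hε.le (hG hv))).1
    have h4 : 1 / ‖expMap l v‖ ≤ 1 / (16 / ε) := by
      gcongr; linarith
    rw [one_div_div] at h4
    linarith
  · intro v hv
    rw [mul_div_cancel₀ _ (two_ne_zero)]
    refine closedBall_subset_rect ?_
    simpa [innerCell] using hG hv

lemma dnorm_mul_le_of_near (hl : l ≠ 0) {n : ℕ} {v : ℂ} {r : ℝ} (hT : pullSum l n v ≤ 1 / 40)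
    (hr : 14 ≤ r * dnorm l n v) :
    ball ((expMap l)^[n] v) 10 ⊆
      (expMap l)^[n] '' {v' | v' ∈ closedBall v r ∧ dnorm l n v' ≤ 4 / 3 * dnorm l n v} := by
  intro ζ hζ
  have hs : ‖ζ - (expMap l)^[n] v‖ < 10 := by rw [← dist_eq_norm]; exact hζ
  have hT0 := pullSum_nonneg (l := l) n v
  have hs0 := norm_nonneg (ζ - (expMap l)^[n] v)
  have hsT : ‖ζ - (expMap l)^[n] v‖ * pullSum l n v ≤ 1 / 4 := by nlinarith
  have hD := dnorm_pos hl n v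
  obtain ⟨v', h1, h2, -, h4⟩ := exists_branch hl n v ζ (by linarith)
  refine ⟨v', ⟨?_, ?_⟩, h1⟩
  · rw [mem_closedBall, dist_eq_norm]
    have h5 : ‖v' - v‖ * (dnorm l n v * (3 / 4)) ≤ 10 := by
      refine le_trans ?_ (h2.trans hs.le)
      gcongr
      linarith
    have h6 : ‖v' - v‖ * dnorm l n v ≤ r * dnorm l n v := by nlinarith
    exact le_of_mul_le_mul_right h6 hD
  · have h5 : dnorm l n v' * (3 / 4) ≤ dnorm l n v := by
      refine le_trans ?_ h4
      have := dnorm_pos hl n v'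
      gcongr
      linarith
    linarith

lemma null_image {E : Set ℂ} (hinv : expMap l ⁻¹' E = E) (n : ℕ) {S : Set ℂ}
    (h : volume (E ∩ S) = 0) : volume (E ∩ (expMap l)^[n] '' S) = 0 := by
  have h1 : volume ((expMap l)^[n] '' (E ∩ S)) = 0 :=
    addHaar_image_eq_zero_of_differentiableOn_of_addHaar_eq_zero volume
      ((differentiable_iterate n).restrictScalars ℝ).differentiableOn h
  refine measure_mono_null ?_ h1
  rintro _ ⟨hy, v, hv, rfl⟩
  exact ⟨v, ⟨(iterate_mem_iff hinv n v).1 hy, hv⟩, rfl⟩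

lemma mem_add_period_iff {E : Set ℂ} (hinv : expMap l ⁻¹' E = E) (p : ℂ) (k : ℤ) :
    p + k * (2 * Real.pi * I) ∈ E ↔ p ∈ E := by
  rw [← iterate_mem_iff hinv 1 p, ← iterate_mem_iff hinv 1]
  simp only [Function.iterate_one, expMap]
  rw [exp_periodic.int_mul k p]

lemma null_periodic {E : Set ℂ} (hinv : expMap l ⁻¹' E = E) {S S' : Set ℂ}
    (h : volume (E ∩ S) = 0) (hS : ∀ p ∈ S', ∃ k : ℤ, p + k * (2 * Real.pi * I) ∈ S) :
    volume (E ∩ S') = 0 := by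
  have h1 : volume (⋃ k : ℤ, (fun p : ℂ => p + k * (2 * Real.pi * I)) ⁻¹' (E ∩ S)) = 0 := by
    refine measure_iUnion_null fun k => ?_
    rw [measure_preimage_add_right]
    exact h
  refine measure_mono_null ?_ h1
  rintro p ⟨hpE, hp⟩
  obtain ⟨k, hk⟩ := hS p hp
  exact mem_iUnion.2 ⟨k, (mem_add_period_iff hinv p k).2 hpE, hk⟩

lemma exists_shift (p : ℂ) (c : ℝ) : ∃ k : ℤ, (p + k * (2 * Real.pi * I)).re = p.re ∧
    c ≤ (p + k * (2 * Real.pi * I)).im ∧ (p + k * (2 * Real.pi * I)).im < c + 2 * Real.pi := by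
  have hpi := Real.pi_pos
  refine ⟨-⌊(p.im - c) / (2 * Real.pi)⌋, by simp, ?_⟩
  have h1 := Int.floor_le ((p.im - c) / (2 * Real.pi))
  have h2 := Int.lt_floor_add_one ((p.im - c) / (2 * Real.pi))
  rw [le_div_iff₀ (by linarith)] at h1
  rw [div_lt_iff₀ (by linarith)] at h2
  have h3 : (p + ((-⌊(p.im - c) / (2 * Real.pi)⌋ : ℤ) : ℂ) * (2 * Real.pi * I)).im
      = p.im - ⌊(p.im - c) / (2 * Real.pi)⌋ * (2 * Real.pi) := by
    simp; ring
  rw [h3]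
  constructor <;> nlinarith

lemma null_strip_of_ball {E : Set ℂ} (hinv : expMap l ⁻¹' E = E) {w : ℂ}
    (h : volume (E ∩ ball w 10) = 0) : volume (E ∩ {p | |p.re - w.re| < 5}) = 0 := by
  refine null_periodic hinv h fun p hp => ?_
  obtain ⟨k, h1, h2, h3⟩ := exists_shift p (w.im - Real.pi)
  refine ⟨k, ?_⟩
  rw [mem_ball, dist_eq_norm]
  refine (norm_le_abs_re_add_abs_im _).trans_lt ?_
  rw [sub_re, sub_im, h1]
  have h4 : |p.re - w.re| < 5 := hp
  have h5 : |(p + k * (2 * Real.pi * I)).im - w.im| ≤ Real.pi :=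
    abs_le.2 ⟨by linarith, by linarith⟩
  linarith [Real.pi_lt_d2]

lemma null_annulus {E : Set ℂ} (hl : l ≠ 0) (hinv : expMap l ⁻¹' E = E) {x0 a : ℝ}
    (h : volume (E ∩ {p | |p.re - x0| < a}) = 0) :
    volume (E ∩ {w | ‖l‖ * Real.exp (x0 - a) < ‖w‖ ∧ ‖w‖ < ‖l‖ * Real.exp (x0 + a)}) = 0 := by
  refine measure_mono_null ?_ (null_image hinv 1 h)
  refine inter_subset_inter_right _ ?_
  rintro w ⟨h1, h2⟩
  have hlp := norm_pos_iff.2 hl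
  have hw : w / l ≠ 0 := by
    have : 0 < ‖w‖ := lt_trans (mul_pos hlp (Real.exp_pos _)) h1
    exact div_ne_zero (norm_pos_iff.1 this) hl
  refine ⟨log (w / l), ?_, ?_⟩
  · have h3 : x0 - a < Real.log ‖w / l‖ := by
      rw [Real.lt_log_iff_exp_lt (norm_pos_iff.2 hw), norm_div, lt_div_iff₀ hlp]; linarith
    have h4 : Real.log ‖w / l‖ < x0 + a := by
      rw [Real.log_lt_iff_lt_exp (norm_pos_iff.2 hw), norm_div, div_lt_iff₀ hlp]; linarith
    simp only [mem_ofPred_eq, log_re]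
    exact abs_lt.2 ⟨by linarith, by linarith⟩
  · simp only [Function.iterate_one, expMap]
    rw [exp_log hw]; field_simp

lemma exists_max_on_circle (n : ℕ) {ρ : ℝ} (hρ : 0 < ρ) :
    ∃ u : ℂ, ‖u‖ = ρ ∧ ((expMap l)^[n] 0).re ≤ ((expMap l)^[n] u).re := by
  have hd : DiffContOnCl ℂ (fun z => exp ((expMap l)^[n] z)) (ball 0 ρ) :=
    (differentiable_exp.comp (differentiable_iterate n)).diffContOnCl
  obtain ⟨u, hu, hmax⟩ := Complex.exists_mem_frontier_isMaxOn_norm isBounded_ball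
    ⟨0, mem_ball_self hρ⟩ hd
  rw [frontier_ball _ hρ.ne'] at hu
  refine ⟨u, by simpa using hu, ?_⟩
  have h1 := hmax (subset_closure (mem_ball_self hρ))
  simp only [Function.comp_apply, mem_ofPred_eq, norm_exp, Real.exp_le_exp] at h1
  exact h1

lemma exists_circle_point (hl : l ≠ 0) (hX : ∀ n, 10 ^ 5 ≤ ((expMap l)^[n + 1] 0).re) {ρ : ℝ}
    (hρ : 0 < ρ) : ∃ n u, ‖u‖ = ρ ∧ 10 ^ 5 ≤ ((expMap l)^[n] u).re ∧ pullSum l n u ≤ 1 / 40 ∧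
      500 ≤ ρ * dnorm l n u := by
  have hA := norm_ge_of_re' hX
  rcases lt_or_ge ρ (1 / 100) with h | h
  · obtain ⟨m, hm1, hm2⟩ := exists_scale hA hρ h
    obtain ⟨u, hu, hre⟩ := exists_max_on_circle (l := l) (m + 2) hρ
    have hre' := (hX (m + 1)).trans hre
    have hn := hre'.trans (re_le_norm _)
    have hx : ‖u‖ * dnorm l m 0 ≤ 1 / 8 := by rw [hu]; linarith
    have h1 := pullSum_shadow_le hl hA (n := 0) (v := u) hx
    obtain ⟨-, h2, -, -⟩ := shadow hA hx le_rfl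
    have h3 : 8 / 3 / ‖(expMap l)^[m + 1] 0‖ ≤ 1 := by
      rw [div_le_one (iterate_succ_norm_pos hl m 0)]
      linarith [hA m]
    have h4 : pullSum l (m + 1) u ≤ 1 := by
      rw [zero_add] at h1
      simp only [pullSum, zero_div, mul_zero, zero_add] at h1
      exact h1.trans h3
    refine ⟨m + 2, u, hu, hre', ?_, ?_⟩
    · refine (pullSum_succ_le (n := m + 1) (v := u) (a := 2) (b := 10 ^ 5) (by norm_num)
        (by linarith) hn).trans (by norm_num)
    · rw [dnorm_succ]
      have h5 := dnorm_zero_pos hA (m + 1)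
      rw [hu] at h2
      have h6 : dnorm l (m + 1) 0 * (3 / 4) ≤ dnorm l (m + 1) u := by
        refine le_trans ?_ h2
        gcongr
        linarith
      have h7 : 1 / 100 * (3 / 4) ≤ ρ * dnorm l (m + 1) u := by nlinarith
      have h8 : 1 / 100 * (3 / 4) * 10 ^ 5 ≤ (ρ * dnorm l (m + 1) u) * ‖(expMap l)^[m + 1 + 1] u‖ :=
        mul_le_mul h7 hn (by norm_num) (by linarith)
      rw [← mul_assoc]
      linarith
  · obtain ⟨u, hu, hre⟩ := exists_max_on_circle (l := l) 1 hρ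
    have hre' := (hX 0).trans hre
    have hn := hre'.trans (re_le_norm _)
    refine ⟨1, u, hu, hre', ?_, ?_⟩
    · refine (pullSum_succ_le (n := 0) (v := u) (a := 1) (b := 10 ^ 5) (by norm_num)
        (by simp [pullSum]) hn).trans (by norm_num)
    · rw [dnorm_succ, dnorm_zero, one_mul]
      calc (500 : ℝ) ≤ 1 / 100 * 10 ^ 5 := by norm_num
        _ ≤ _ := mul_le_mul h hn (by norm_num) hρ.le

lemma null_ball_of_null {E : Set ℂ} (hl : l ≠ 0) (hinv : expMap l ⁻¹' E = E) {n : ℕ} {v : ℂ} {r : ℝ}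
    (hT : pullSum l n v ≤ 1 / 40) (hr : 14 ≤ r * dnorm l n v)
    (h : volume (E ∩ closedBall v r) = 0) :
    volume (E ∩ ball ((expMap l)^[n] v) 10) = 0 := by
  refine measure_mono_null (inter_subset_inter_right _ (dnorm_mul_le_of_near hl hT hr)) ?_
  refine null_image hinv n (measure_mono_null (inter_subset_inter_right _ ?_) h)
  exact fun v hv => hv.1

lemma null_strip_of_annulus {E : Set ℂ} (hinv : expMap l ⁻¹' E = E) {a b c t : ℝ} (hc : a < c)
    (ht : t + c + 2 * Real.pi ≤ b) (hc0 : 0 ≤ c)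
    (h : volume (E ∩ {w | a < ‖w‖ ∧ ‖w‖ < b}) = 0) :
    volume (E ∩ {p | |p.re - 0| < t}) = 0 := by
  refine null_periodic hinv h fun p hp => ?_
  obtain ⟨k, h1, h2, h3⟩ := exists_shift p c
  refine ⟨k, ?_, ?_⟩
  · refine hc.trans_le (h2.trans (im_le_norm _))
  · refine (norm_le_abs_re_add_abs_im _).trans_lt ?_
    rw [h1, abs_of_nonneg (hc0.trans h2)]
    have h4 : |p.re - 0| < t := hp
    rw [sub_zero] at h4
    linarith

lemma null_of_null_open {E O : Set ℂ} (hl : Real.exp 200 ≤ ‖l‖)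
    (hX : ∀ n, 10 ^ 5 ≤ ((expMap l)^[n + 1] 0).re) (hinv : expMap l ⁻¹' E = E)
    (hO : IsOpen O) (hne : O.Nonempty) (h : volume (E ∩ O) = 0) : volume E = 0 := by
  have hl0 : l ≠ 0 := norm_pos_iff.1 ((Real.exp_pos _).trans_le hl)
  have hlp : 0 < ‖l‖ := norm_pos_iff.2 hl0
  have he5 : (32 : ℝ) ≤ Real.exp 5 := by
    refine le_trans ?_ (pow_lt_exp (k := 5) (x := 1) (by norm_num) (by norm_num))
    norm_num
  obtain ⟨z, hz⟩ := hne
  obtain ⟨r, hr, hrO⟩ := Metric.nhds_basis_closedBall.mem_iff.1 (hO.mem_nhds hz)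
  obtain ⟨k, hk⟩ := pow_unbounded_of_one_lt (14 / r) (show (1 : ℝ) < 40 by norm_num)
  obtain ⟨n, -, hT, hD⟩ := exists_good hl hX z k
  have hb1 : volume (E ∩ ball ((expMap l)^[n] z) 10) = 0 := by
    refine null_ball_of_null hl0 hinv (r := r) hT ?_
      (measure_mono_null (inter_subset_inter_right _ hrO) h)
    have := hk.le.trans hD
    rwa [div_le_iff₀' hr] at this
  have ha1 := null_annulus hl0 hinv (null_strip_of_ball hinv hb1)
  set x0 := ((expMap l)^[n] z).re
  have hρ : 0 < ‖l‖ * Real.exp x0 := mul_pos hlp (Real.exp_pos _)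
  obtain ⟨M, u, hu, hre, hT2, hD2⟩ := exists_circle_point hl0 hX hρ
  set ρ := ‖l‖ * Real.exp x0 with hρd
  have hb2 : volume (E ∩ ball ((expMap l)^[M] u) 10) = 0 := by
    refine null_ball_of_null hl0 hinv (r := 14 * ρ / 500) hT2 (by linarith) ?_
    refine measure_mono_null (inter_subset_inter_right _ ?_) ha1
    intro v hv
    rw [mem_closedBall, dist_eq_norm] at hv
    have h1 := norm_sub_norm_le v u
    have h2 := norm_sub_norm_le u v
    rw [norm_sub_rev] at h2
    rw [hu] at h1 h2
    have e1 : ‖l‖ * Real.exp (x0 + 5) = ρ * Real.exp 5 := by rw [Real.exp_add, hρd]; ring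
    have e2 : ‖l‖ * Real.exp (x0 - 5) = ρ / Real.exp 5 := by rw [Real.exp_sub, hρd]; ring
    constructor
    · rw [e2, div_lt_iff₀ (Real.exp_pos _)]
      nlinarith
    · rw [e1]
      nlinarith
  have ha2 := null_annulus hl0 hinv (null_strip_of_ball hinv hb2)
  set x1 := ((expMap l)^[M] u).re
  have hl200 : 201 ≤ ‖l‖ := le_trans (by linarith [Real.add_one_le_exp (200 : ℝ)]) hl
  have hpi := Real.pi_lt_d2
  have hpi0 := Real.pi_pos
  have h20 : volume (E ∩ {p | |p.re - 0| < 20}) = 0 := by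
    set a := ‖l‖ * Real.exp (x1 - 5) with ha
    have ha20 : 20 ≤ a := by
      have := Real.one_le_exp (show 0 ≤ x1 - 5 by linarith)
      nlinarith
    have e1 : ‖l‖ * Real.exp (x1 + 5) = a * Real.exp 5 * Real.exp 5 := by
      rw [ha, mul_assoc, mul_assoc, ← Real.exp_add, ← Real.exp_add]; ring_nf
    have h6 : a * 32 * 1 ≤ a * Real.exp 5 * Real.exp 5 := by gcongr; linarith
    refine null_strip_of_annulus hinv (c := 2 * a) ?_ ?_ ?_ ha2
    · linarith
    · rw [e1]; linarith
    · linarith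
  have hall : ∀ k : ℕ, volume (E ∩ {p | |p.re - 0| < (k : ℝ) + 20}) = 0 := by
    intro k
    induction k with
    | zero => simpa using h20
    | succ k ih =>
      have ha := null_annulus hl0 hinv ih
      rw [zero_sub, zero_add] at ha
      set β := (k : ℝ) + 20 with hβ
      have hβ20 : 20 ≤ β := by rw [hβ]; linarith [(Nat.cast_nonneg k : (0 : ℝ) ≤ k)]
      have h7 := Real.add_one_le_exp β
      have h8 : Real.exp (-β) ≤ 1 := Real.exp_le_one_iff.2 (by linarith)
      have h9 : 201 * Real.exp β ≤ ‖l‖ * Real.exp β := by gcongr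
      have := null_strip_of_annulus hinv (c := ‖l‖ * Real.exp β / 4) (t := β + 1) (by nlinarith)
        (by nlinarith) (by nlinarith) ha
      rw [hβ] at this
      push_cast
      rwa [add_right_comm] at this
  have hun : volume (⋃ k : ℕ, (E ∩ {p | |p.re - 0| < (k : ℝ) + 20})) = 0 := measure_iUnion_null hall
  refine measure_mono_null (fun p hp => ?_) hun
  obtain ⟨k, hk⟩ := exists_nat_gt |p.re - 0|
  exact mem_iUnion.2 ⟨k, hp, by simp only [mem_ofPred_eq]; linarith⟩

lemma dens_add_period {E : Set ℂ} (hinv : expMap l ⁻¹' E = E) (z : ℂ) (k : ℤ) :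
    dens E (z + k * (2 * Real.pi * I)) = dens E z := by
  unfold dens
  congr 1
  rw [measureReal_def, measureReal_def,
    ← measure_preimage_add_right volume (k * (2 * Real.pi * I)) (E ∩ cell _)]
  congr 2
  ext q
  simp only [mem_preimage, mem_inter_iff, mem_add_period_iff hinv]
  refine and_congr_right fun _ => ?_
  simp only [cell, rect, mem_ofPred_eq, add_re, add_im, mul_re, mul_im, I_re, I_im]
  simp
  intro _ _ _
  constructor <;> intro h <;> linarith

lemma exists_dens_lower {E : Set ℂ} (hl : Real.exp 200 ≤ ‖l‖)
    (hX : ∀ n, 10 ^ 5 ≤ ((expMap l)^[n + 1] 0).re) (hinv : expMap l ⁻¹' E = E)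
    (hE : volume E ≠ 0) (a : ℝ) : ∃ η, 0 < η ∧ ∀ z : ℂ, |z.re| ≤ a → η ≤ dens E z := by
  have hpos : ∀ z r, 0 < r → 0 < volume.real (E ∩ ball z r) := by
    intro z r hr
    refine ENNReal.toReal_pos (fun h => hE ?_) ?_
    · exact null_of_null_open hl hX hinv isOpen_ball ⟨z, mem_ball_self hr⟩ h
    · exact ((measure_mono inter_subset_right).trans_lt measure_ball_lt_top).ne
  have hpi0 := Real.pi_pos
  have hloc : ∀ z : ℂ, ∃ η > 0, ∀ w ∈ ball z (1 / 4), η ≤ dens E w := by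
    intro z
    set p : ℂ := z + (1 / 2 : ℝ) + (1 : ℝ) * I with hp
    have hpr : p.re = z.re + 1 / 2 := by simp [hp]
    have hpim : p.im = z.im + 1 := by simp [hp]
    refine ⟨volume.real (E ∩ ball p (1 / 4)) / (2 * Real.pi),
      div_pos (hpos _ _ (by norm_num)) (by positivity), fun w hw => ?_⟩
    unfold dens
    gcongr
    · exact ((measure_mono inter_subset_right).trans_lt (volume_cell_ne_top w).lt_top).ne
    · intro q hq
      rw [mem_ball, dist_eq_norm] at hq hw
      have h1 := (abs_re_le_norm _).trans_lt hq
      have h2 := (abs_im_le_norm _).trans_lt hq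
      have h3 := (abs_re_le_norm _).trans_lt hw
      have h4 := (abs_im_le_norm _).trans_lt hw
      rw [sub_re, abs_lt] at h1 h3
      rw [sub_im, abs_lt] at h2 h4
      have := Real.pi_gt_three
      refine ⟨⟨?_, ?_⟩, ?_, ?_⟩ <;> linarith
  have hcpt : IsCompact (Icc (-a) a ×ℂ Icc 0 (2 * Real.pi)) :=
    isCompact_Icc.reProdIm isCompact_Icc
  have hK : ∃ η, 0 < η ∧ ∀ z ∈ (Icc (-a) a ×ℂ Icc 0 (2 * Real.pi)), η ≤ dens E z := by
    refine hcpt.induction_on (p := fun S => ∃ η, 0 < η ∧ ∀ z ∈ S, η ≤ dens E z)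
      ⟨1, one_pos, by simp⟩ ?_ ?_ ?_
    · rintro s t hst ⟨η, h1, h2⟩
      exact ⟨η, h1, fun z hz => h2 z (hst hz)⟩
    · rintro s t ⟨η, h1, h2⟩ ⟨η', h1', h2'⟩
      refine ⟨min η η', lt_min h1 h1', ?_⟩
      rintro z (hz | hz)
      · exact (min_le_left _ _).trans (h2 z hz)
      · exact (min_le_right _ _).trans (h2' z hz)
    · intro z _
      obtain ⟨η, h1, h2⟩ := hloc z
      exact ⟨ball z (1 / 4), mem_nhdsWithin_of_mem_nhds (ball_mem_nhds z (by norm_num)), η, h1, h2⟩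
  obtain ⟨η, h1, h2⟩ := hK
  refine ⟨η, h1, fun z hz => ?_⟩
  obtain ⟨k, k1, k2, k3⟩ := exists_shift z 0
  have h3 := h2 (z + k * (2 * Real.pi * I)) ⟨by rw [mem_preimage, k1]; exact abs_le.1 hz, k2, by linarith⟩
  exact h3.trans (dens_add_period hinv z k).le

lemma le_iterate_of_le {G : ℝ → ℝ} (hG : ∀ x, x ≤ G x) (i : ℕ) (x : ℝ) : x ≤ G^[i] x := by
  induction i with
  | zero => simp
  | succ i ih => rw [Function.iterate_succ_apply']; exact ih.trans (hG _)

/-- Lower density bounds propagate to the right by pushing forward finitely many times. -/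
lemma dens_right_iterate {E : Set ℂ} (hl : l ≠ 0) (hE : MeasurableSet E)
    (hinv : expMap l ⁻¹' E = E) {G : ℝ → ℝ} (hGm : Monotone G) (hG : ∀ x, x ≤ G x)
    (hGl : ∀ x, ‖l‖ * Real.exp (x + 1) ≤ G x) {ε η α τ : ℝ} (hε : 0 < ε) (hε' : ε ≤ 1 / 40)
    (hη : 0 ≤ η) (hα : 16 / ε ≤ ‖l‖ * Real.exp α)
    (h0 : ∀ z : ℂ, |z.re| ≤ α → η ≤ dens E z)
    (hL : ∀ z : ℂ, α ≤ -z.re → -z.re ≤ τ → (1 - 10 * ε) * η ≤ dens E z) (i : ℕ) :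
    ∀ z : ℂ, α ≤ z.re → G^[i] z.re ≤ τ → (1 - (1 / 2) ^ i - 30 * ε) * η ≤ dens E z := by
  induction i with
  | zero =>
    intro z _ _
    refine le_trans ?_ (dens_nonneg E z)
    nlinarith
  | succ i ih =>
    intro z hz hzτ
    rw [Function.iterate_succ_apply] at hzτ
    have hpow : ((1 : ℝ) / 2) ^ i ≤ 1 := pow_le_one₀ (by norm_num) (by norm_num)
    have hpow0 : 0 ≤ ((1 : ℝ) / 2) ^ i := by positivity
    set c := (1 - (1 / 2) ^ (i + 1) - 20 * ε) * η with hc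
    have hc0 : 0 ≤ c := mul_nonneg (by rw [pow_succ]; linarith) hη
    have hcη : c ≤ η := by
      rw [hc, pow_succ]
      nlinarith [mul_nonneg hpow0 hη, mul_nonneg hε.le hη]
    have key : ∀ ζ : ℂ, 0 ≤ ζ.re → ζ.re ≤ G z.re → 2 * c ≤ dens E ζ + dens E (-ζ) := by
      intro ζ h1 h2
      rcases le_total ζ.re α with h3 | h3
      · have h4 := h0 ζ (by rwa [abs_of_nonneg h1])
        have h5 := h0 (-ζ) (by rwa [neg_re, abs_neg, abs_of_nonneg h1])
        linarith
      · have h6 : G^[i] ζ.re ≤ τ := ((hGm.iterate i) h2).trans hzτ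
        have h4 := ih ζ h3 h6
        have h5 := hL (-ζ) (by simpa using h3)
          (by simpa using (le_iterate_of_le hG i ζ.re).trans h6)
        refine le_trans (le_of_eq ?_) (add_le_add h4 h5)
        rw [hc, pow_succ]; ring
    have h1 := dens_right hl hE hinv hε (by linarith) hc0 (z := z)
      (hα.trans (by gcongr)) (by
        intro ζ hζ
        have h2 := hζ.trans (hGl z.re)
        have h3 := (abs_re_le_norm ζ).trans h2
        rcases le_total 0 ζ.re with h4 | h4
        · exact key ζ h4 ((le_abs_self _).trans h3)
        · have := key (-ζ) (by simpa using h4) (by rw [neg_re]; exact (neg_le_abs _).trans h3)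
          rwa [neg_neg, add_comm] at this)
    refine le_trans ?_ h1
    have h2 : ε * c ≤ ε * η := by gcongr
    have h3 : c = (1 - (1 / 2) ^ (i + 1) - 20 * ε) * η := hc
    nlinarith

/-- Quantitative recurrence data along the singular orbit, which yields uniform density bounds. -/
structure Recurrence (l : ℂ) (G : ℝ → ℝ) (α τ : ℕ → ℝ) : Prop where
  mono : Monotone G
  le : ∀ x, x ≤ G x
  bound : ∀ x, ‖l‖ * Real.exp (x + 1) ≤ G x
  tendsto : Tendsto α atTop atTop
  large : ∀ j : ℕ, 960 * ((j : ℝ) + 2) ^ 2 ≤ α j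
  iterate : ∀ j : ℕ, G^[2 * (j + 2) ^ 2] (α (j + 1)) ≤ τ j
  landing : ∀ (j : ℕ) (x : ℝ), α j ≤ x → x ≤ τ j → ∃ (m : ℕ) (B : ℝ),
    ‖l‖ * Real.exp (-x) * dnorm l m 0 < 1 / 100 ∧
    1 / 100 ≤ ‖l‖ * Real.exp (-x) * dnorm l (m + 1) 0 ∧
    Real.exp (60000 * ((j : ℝ) + 2) ^ 2) ≤ ‖(expMap l)^[m + 1] 0‖ ∧
    Real.exp (60000 * ((j : ℝ) + 2) ^ 2) ≤ ‖(expMap l)^[m + 2] 0‖ ∧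
    ‖(expMap l)^[m + 1] 0‖ ≤ B ∧ ‖(expMap l)^[m + 2] 0‖ ≤ B ∧
    Real.exp (60000 * ((j : ℝ) + 2) ^ 2) * B ≤ α j

lemma dens_bound_succ {E : Set ℂ} (hl : Real.exp 200 ≤ ‖l‖)
    (hX : ∀ n, 10 ^ 5 ≤ ((expMap l)^[n + 1] 0).re) (hE : MeasurableSet E)
    (hinv : expMap l ⁻¹' E = E) {G : ℝ → ℝ} {α τ : ℕ → ℝ} (R : Recurrence l G α τ) {η : ℝ}
    (hη : 0 ≤ η) (j : ℕ) (h0 : ∀ z : ℂ, |z.re| ≤ α j → η ≤ dens E z) (z : ℂ)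
    (hz : |z.re| ≤ α (j + 1)) : (1 - 1 / ((j : ℝ) + 2) ^ 2) * η ≤ dens E z := by
  have hl0 : l ≠ 0 := norm_pos_iff.1 ((Real.exp_pos _).trans_le hl)
  have hA := norm_ge_of_re' hX
  have hj : (0 : ℝ) ≤ j := Nat.cast_nonneg j
  set q : ℝ := ((j : ℝ) + 2) ^ 2 with hq
  have hq4 : 4 ≤ q := by rw [hq]; nlinarith
  set ε : ℝ := 1 / (60 * q) with hε
  have hε0 : 0 < ε := by positivity
  have hεq : ε * q = 1 / 60 := by rw [hε]; field_simp
  have hε' : ε ≤ 1 / 40 := by nlinarith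
  have h1000 : 1000 / ε = 60000 * q := by rw [hε]; field_simp; norm_num
  have h16 : 16 / ε = 960 * q := by rw [hε]; field_simp; norm_num
  have hqi : 1 / q = 60 * ε := by rw [hε]; field_simp
  have hL : ∀ z : ℂ, α j ≤ -z.re → -z.re ≤ τ j → (1 - 10 * ε) * η ≤ dens E z := by
    intro z h1 h2
    obtain ⟨m, B, a1, a2, a3, a4, a5, a6, a7⟩ := R.landing j (-z.re) h1 h2
    rw [neg_neg] at a1 a2
    rw [← hq, ← h1000] at a3 a4 a7
    exact dens_left hl0 hA hE hinv hε0 (by linarith) hη a1 a2 a3 a4 a5 a6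
      fun ζ hζ => h0 ζ (hζ.trans a7)
  have hG0 : α (j + 1) ≤ τ j := (le_iterate_of_le R.le _ _).trans (R.iterate j)
  have hα16 : 16 / ε ≤ ‖l‖ * Real.exp (α j) := by
    rw [h16]
    have h1 := R.large j
    rw [← hq] at h1
    have h2 := Real.add_one_le_exp (α j)
    have h3 : 1 ≤ ‖l‖ := (Real.one_le_exp (by norm_num)).trans hl
    nlinarith [Real.exp_pos (α j)]
  rw [hqi]
  have hεη := mul_nonneg hε0.le hη
  rcases le_or_gt |z.re| (α j) with h1 | h1
  · have := h0 z h1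
    nlinarith
  · rcases lt_abs.1 h1 with h2 | h2
    · have h3 := dens_right_iterate hl0 hE hinv R.mono R.le R.bound hε0 hε' hη hα16 h0 hL
        (2 * (j + 2) ^ 2) z h2.le
        ((R.mono.iterate _ ((le_abs_self _).trans hz)).trans (R.iterate j))
      refine le_trans ?_ h3
      have h4 : ((1 : ℝ) / 2) ^ (2 * (j + 2) ^ 2) ≤ 30 * ε := by
        have h5 : ((2 * (j + 2) ^ 2 : ℕ) : ℝ) < 2 ^ (2 * (j + 2) ^ 2) := by
          exact_mod_cast Nat.lt_two_pow_self
        push_cast at h5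
        rw [← hq] at h5
        rw [one_div_pow, div_le_iff₀ (by positivity)]
        nlinarith
      exact mul_le_mul_of_nonneg_right (by linarith) hη
    · have h3 := hL z h2.le ((neg_le_abs _).trans (hz.trans hG0))
      nlinarith

lemma exists_uniform_dens {E : Set ℂ} (hl : Real.exp 200 ≤ ‖l‖)
    (hX : ∀ n, 10 ^ 5 ≤ ((expMap l)^[n + 1] 0).re) (hE : MeasurableSet E)
    (hinv : expMap l ⁻¹' E = E) {G : ℝ → ℝ} {α τ : ℕ → ℝ} (R : Recurrence l G α τ)
    (hE0 : volume E ≠ 0) : ∃ η, 0 < η ∧ ∀ z : ℂ, η ≤ dens E z := by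
  obtain ⟨η, hη, h⟩ := exists_dens_lower hl hX hinv hE0 (α 0)
  have hall : ∀ j : ℕ, ∀ z : ℂ, |z.re| ≤ α j →
      η / 2 * (((j : ℝ) + 2) / ((j : ℝ) + 1)) ≤ dens E z := by
    intro j
    induction j with
    | zero => intro z hz; have := h z hz; simpa using this
    | succ j ih =>
      intro z hz
      have := dens_bound_succ hl hX hE hinv R (by positivity) j ih z hz
      refine le_trans (le_of_eq ?_) this
      push_cast
      field_simp
      ring
  refine ⟨η / 2, by positivity, fun z => ?_⟩
  obtain ⟨j, hj⟩ := (R.tendsto.eventually_ge_atTop |z.re|).exists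
  refine le_trans ?_ (hall j z hj)
  have : 1 ≤ ((j : ℝ) + 2) / ((j : ℝ) + 1) := by
    rw [one_le_div (by positivity)]; linarith
  nlinarith

lemma continuous_dnorm (n : ℕ) : Continuous (dnorm l n) :=
  continuous_finsetProd _ fun i _ => (continuous_iterate (i + 1)).norm

lemma volume_ball_le {E : Set ℂ} (hl : l ≠ 0) (hE : MeasurableSet E) (hinv : expMap l ⁻¹' E = E)
    {n : ℕ} {v : ℂ} {r : ℝ} (hT : pullSum l n v ≤ 1 / 40) (hr : 14 ≤ r * dnorm l n v) :
    volume.real (E ∩ ball ((expMap l)^[n] v) 10) ≤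
      (4 / 3 * dnorm l n v) ^ 2 * volume.real (E ∩ closedBall v r) := by
  have hD := dnorm_pos hl n v
  set U : Set ℂ := {v' | v' ∈ closedBall v r ∧ dnorm l n v' ≤ 4 / 3 * dnorm l n v} with hU
  have hUm : MeasurableSet U := measurableSet_closedBall.inter
    (measurableSet_le (continuous_dnorm n).measurable measurable_const)
  have hsub : E ∩ ball ((expMap l)^[n] v) 10 ⊆ (expMap l)^[n] '' (E ∩ U) := by
    rintro w ⟨hw1, hw2⟩
    obtain ⟨v', h1, rfl⟩ := dnorm_mul_le_of_near hl hT hr hw2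
    exact ⟨v', ⟨(iterate_mem_iff hinv n v').1 hw1, h1⟩, rfl⟩
  have h1 := addHaar_image_le_lintegral_abs_det_fderiv volume (hE.inter hUm)
    (fun v' (_ : v' ∈ E ∩ U) =>
      hasFDerivWithinAt_mulR (hasDerivAt_iterate (l := l) n v').hasDerivWithinAt)
  have h2 : ∫⁻ x in E ∩ U, ENNReal.ofReal
      |(mulR (∏ i ∈ Finset.range n, (expMap l)^[i + 1] x)).det| ≤
      ∫⁻ _ in E ∩ U, ENNReal.ofReal ((4 / 3 * dnorm l n v) ^ 2) := by
    refine setLIntegral_mono measurable_const fun x hx => ?_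
    rw [det_mulR, norm_prod_iterate, abs_of_nonneg (sq_nonneg _)]
    have := (dnorm_pos hl n x).le
    have := hx.2.2
    gcongr
  rw [setLIntegral_const] at h2
  have h3 : volume (E ∩ ball ((expMap l)^[n] v) 10) ≤
      ENNReal.ofReal ((4 / 3 * dnorm l n v) ^ 2) * volume (E ∩ closedBall v r) := by
    refine ((measure_mono hsub).trans (h1.trans h2)).trans ?_
    gcongr
    exact fun x hx => hx.1
  have h4 := ENNReal.toReal_mono (ENNReal.mul_ne_top ENNReal.ofReal_ne_top
    ((measure_mono inter_subset_right).trans_lt measure_closedBall_lt_top).ne) h3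
  rwa [ENNReal.toReal_mul, ENNReal.toReal_ofReal (sq_nonneg _)] at h4

lemma ergodic_of_recurrence (hl : Real.exp 200 ≤ ‖l‖)
    (hX : ∀ n, 10 ^ 5 ≤ ((expMap l)^[n + 1] 0).re) {G : ℝ → ℝ} {α τ : ℕ → ℝ}
    (R : Recurrence l G α τ) {A : Set ℂ} (hA : MeasurableSet A) (hinv : expMap l ⁻¹' A = A) :
    volume A = 0 ∨ volume Aᶜ = 0 := by
  have hl0 : l ≠ 0 := norm_pos_iff.1 ((Real.exp_pos _).trans_le hl)
  by_contra! hcon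
  obtain ⟨h1, h2⟩ := hcon
  have hinv' : expMap l ⁻¹' Aᶜ = Aᶜ := by rw [preimage_compl, hinv]
  obtain ⟨η, hη, hdens⟩ := exists_uniform_dens hl hX hA.compl hinv' R h2
  have hz : ∃ z ∈ A, Tendsto (fun r => volume (Aᶜ ∩ closedBall z r) / volume (closedBall z r))
      (𝓝[>] 0) (𝓝 (Aᶜ.indicator 1 z)) := by
    by_contra! hno
    have hae := Besicovitch.ae_tendsto_measure_inter_div_of_measurableSet (volume : Measure ℂ)
      hA.compl
    exact h1 (measure_mono_null (fun z hzA => hno z hzA) hae)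
  obtain ⟨z, hzA, ht⟩ := hz
  rw [indicator_of_notMem (by simpa using hzA)] at ht
  have hpi := Real.pi_pos
  have hev := ht.eventually (gt_mem_nhds (show (0 : ENNReal) < ENNReal.ofReal (η / 1000) by simpa using by positivity))
  obtain ⟨s, hs, hs2⟩ := mem_nhdsGT_iff_exists_Ioo_subset.1 hev
  have hs0 : 0 < s := hs
  obtain ⟨k, hk⟩ := pow_unbounded_of_one_lt (14 / s) (show (1 : ℝ) < 40 by norm_num)
  obtain ⟨n, -, hT, hD⟩ := exists_good hl hX z k
  have hDp := dnorm_pos hl0 n z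
  set r := 14 / dnorm l n z with hr
  have hr0 : 0 < r := by positivity
  have hrD : r * dnorm l n z = 14 := by rw [hr]; field_simp
  have hrs : r < s := by
    rw [hr, div_lt_iff₀ hDp]
    rw [div_lt_iff₀ hs0] at hk
    nlinarith
  have h3 : volume (Aᶜ ∩ closedBall z r) / volume (closedBall z r) < ENNReal.ofReal (η / 1000) :=
    hs2 ⟨hr0, hrs⟩
  have hcb0 : volume (closedBall z r) ≠ 0 := (measure_closedBall_pos _ _ hr0).ne'
  have hcbt : volume (closedBall z r) ≠ ⊤ := measure_closedBall_lt_top.ne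
  have h4 : volume.real (Aᶜ ∩ closedBall z r) ≤ η / 1000 * (r ^ 2 * Real.pi) := by
    rw [ENNReal.div_lt_iff (Or.inl hcb0) (Or.inl hcbt)] at h3
    have h5 := ENNReal.toReal_mono (ENNReal.mul_ne_top ENNReal.ofReal_ne_top hcbt) h3.le
    rw [ENNReal.toReal_mul, ENNReal.toReal_ofReal (by positivity),
      Measure.addHaar_closedBall_eq_addHaar_ball, ← measureReal_def, ← measureReal_def,
      volume_real_ball z hr0.le] at h5
    exact h5
  have h5 := volume_ball_le hl0 hA.compl hinv' hT hrD.ge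
  set w := (expMap l)^[n] z
  have h6 : 2 * Real.pi * η ≤ volume.real (Aᶜ ∩ ball w 10) := by
    have h7 := hdens w
    have h8 := two_pi_mul_dens Aᶜ w
    have h9 : volume.real (Aᶜ ∩ cell w) ≤ volume.real (Aᶜ ∩ ball w 10) := by
      refine measureReal_mono (inter_subset_inter_right _ ?_)
        ((measure_mono inter_subset_right).trans_lt measure_ball_lt_top).ne
      rintro p ⟨⟨c1, c2⟩, c3, c4⟩
      rw [mem_ball, dist_eq_norm]
      refine (norm_le_abs_re_add_abs_im _).trans_lt ?_
      rw [sub_re, sub_im, abs_of_nonneg (by linarith), abs_of_nonneg (by linarith)]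
      linarith [Real.pi_lt_d2]
    refine le_trans ?_ (h8.le.trans h9)
    gcongr
  have h10 : (4 / 3 * dnorm l n z) ^ 2 * volume.real (Aᶜ ∩ closedBall z r) ≤
      (4 / 3 * dnorm l n z) ^ 2 * (η / 1000 * (r ^ 2 * Real.pi)) := by gcongr
  have h11 : (4 / 3 * dnorm l n z) ^ 2 * (η / 1000 * (r ^ 2 * Real.pi)) =
      (r * dnorm l n z) ^ 2 * (16 / 9 * (η / 1000) * Real.pi) := by ring
  rw [h11, hrD] at h10
  nlinarith [mul_pos hη hpi]

lemma norm_log_sub_log_le {a b : ℂ} (ha : 10 ≤ a.im) (hb : 10 ≤ b.im) :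
    ‖log a - log b‖ ≤ 1 / 10 * ‖a - b‖ := by
  have hs : ∀ x : ℂ, 10 ≤ x.im → x ∈ slitPlane := fun x hx => Or.inr (by linarith : 0 < x.im).ne'
  refine Convex.norm_image_sub_le_of_norm_deriv_le (𝕜 := ℂ) (s := {x : ℂ | 10 ≤ x.im})
    (fun x hx => (hasDerivAt_log (hs x hx)).differentiableAt) (fun x hx => ?_)
    (convex_halfSpace_im_ge 10) hb ha
  rw [(hasDerivAt_log (hs x hx)).deriv, norm_inv, one_div]
  have hx' : 10 ≤ x.im := hx
  gcongr
  exact hx'.trans (im_le_norm x)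

/-- Approximations to an orbit of the singular value with prescribed itinerary `k`. -/
noncomputable def orbitApprox (k : ℕ → ℕ) : ℕ → ℕ → ℂ
  | 0, n => 2 * Real.pi * k n * I
  | p + 1, n => log (orbitApprox k p (n + 1)) - log (orbitApprox k p 0) + 2 * Real.pi * k n * I

lemma log_bounds {k : ℕ → ℕ} (hmono : Monotone k) (h4 : ∀ n, 4 ≤ k n) {n : ℕ} {z : ℂ}
    (h1 : |z.re| ≤ k (n + 1)) (h2 : |z.im - 2 * Real.pi * k n| ≤ Real.pi) :
    10 ≤ z.im ∧ (k n : ℝ) ≤ ‖z‖ ∧ ‖z‖ ≤ 10 * k (n + 1) := by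
  have hpi := Real.pi_gt_three
  have hpi2 := Real.pi_lt_d2
  have h4n : (4 : ℝ) ≤ k n := by exact_mod_cast h4 n
  have h4m : (k n : ℝ) ≤ k (n + 1) := by exact_mod_cast hmono (Nat.le_succ n)
  obtain ⟨h3, h5⟩ := abs_le.1 h2
  have h6 : (k n : ℝ) + 10 ≤ z.im := by nlinarith
  refine ⟨by linarith, by linarith [im_le_norm z], ?_⟩
  refine (norm_le_abs_re_add_abs_im z).trans ?_
  rw [abs_of_nonneg (a := z.im) (by linarith)]
  nlinarith

lemma next_bounds {k : ℕ → ℕ} (hmono : Monotone k) (h4 : ∀ n, 4 ≤ k n)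
    (hexp : ∀ n, 10 * (k (n + 1) : ℝ) ≤ Real.exp (k n)) {n : ℕ} {a b : ℂ}
    (ha1 : |a.re| ≤ k (n + 2)) (ha2 : |a.im - 2 * Real.pi * k (n + 1)| ≤ Real.pi)
    (hb1 : |b.re| ≤ k 1) (hb2 : |b.im - 2 * Real.pi * k 0| ≤ Real.pi) :
    |(log a - log b + 2 * Real.pi * k n * I).re| ≤ k (n + 1) ∧
    |(log a - log b + 2 * Real.pi * k n * I).im - 2 * Real.pi * k n| ≤ Real.pi := by
  obtain ⟨a1, a2, a3⟩ := log_bounds hmono h4 ha1 ha2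
  obtain ⟨b1, b2, b3⟩ := log_bounds hmono h4 hb1 hb2
  have k1 : (4 : ℝ) ≤ k (n + 1) := by exact_mod_cast h4 _
  have k0 : (4 : ℝ) ≤ k 0 := by exact_mod_cast h4 _
  have k01 : (k 0 : ℝ) ≤ k (n + 1) := by exact_mod_cast hmono (Nat.zero_le _)
  have la : Real.log ‖a‖ ≤ k (n + 1) := by
    rw [Real.log_le_iff_le_exp (by linarith)]
    exact a3.trans (hexp _)
  have lb : Real.log ‖b‖ ≤ k 0 := by
    rw [Real.log_le_iff_le_exp (by linarith)]
    exact b3.trans (hexp _)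
  have la0 : 0 ≤ Real.log ‖a‖ := Real.log_nonneg (by linarith)
  have lb0 : 0 ≤ Real.log ‖b‖ := Real.log_nonneg (by linarith)
  constructor
  · have : (log a - log b + 2 * Real.pi * k n * I).re = Real.log ‖a‖ - Real.log ‖b‖ := by
      simp [log_re]
    rw [this, abs_le]
    constructor <;> linarith
  · have : (log a - log b + 2 * Real.pi * k n * I).im - 2 * Real.pi * k n = arg a - arg b := by
      simp [log_im]
    rw [this, abs_le]
    have := arg_nonneg_iff.2 (show 0 ≤ a.im by linarith)
    have := arg_nonneg_iff.2 (show 0 ≤ b.im by linarith)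
    have := arg_le_pi a
    have := arg_le_pi b
    constructor <;> linarith

lemma orbitApprox_bounds {k : ℕ → ℕ} (hmono : Monotone k) (h4 : ∀ n, 4 ≤ k n)
    (hexp : ∀ n, 10 * (k (n + 1) : ℝ) ≤ Real.exp (k n)) (p n : ℕ) :
    |(orbitApprox k p n).re| ≤ k (n + 1) ∧
    |(orbitApprox k p n).im - 2 * Real.pi * k n| ≤ Real.pi := by
  induction p generalizing n with
  | zero => simp [orbitApprox, Real.pi_pos.le]
  | succ p ih =>
    rw [orbitApprox]
    exact next_bounds hmono h4 hexp (ih _).1 (ih _).2 (ih _).1 (ih _).2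

lemma dist_orbitApprox_le {k : ℕ → ℕ} (hmono : Monotone k) (h4 : ∀ n, 4 ≤ k n)
    (hexp : ∀ n, 10 * (k (n + 1) : ℝ) ≤ Real.exp (k n)) {C : ℝ}
    (hC : ∀ n, (k (n + 1) : ℝ) + Real.pi ≤ C * 2 ^ n) (p n : ℕ) :
    dist (orbitApprox k p n) (orbitApprox k (p + 1) n) ≤ C * 2 ^ n * (1 / 2) ^ p := by
  have hb := orbitApprox_bounds hmono h4 hexp
  induction p generalizing n with
  | zero =>
    rw [dist_comm, dist_eq_norm]
    refine (norm_le_abs_re_add_abs_im _).trans ?_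
    have h1 := hb 1 n
    have e1 : (orbitApprox k 1 n - orbitApprox k 0 n).re = (orbitApprox k 1 n).re := by
      simp [orbitApprox]
    have e2 : (orbitApprox k (0 + 1) n - orbitApprox k 0 n).im =
        (orbitApprox k 1 n).im - 2 * Real.pi * k n := by
      simp [orbitApprox]
    rw [zero_add] at *
    rw [e1, e2, pow_zero, mul_one]
    exact (add_le_add h1.1 h1.2).trans (hC n)
  | succ p ih =>
    have hC0 : 0 ≤ C := by
      have := hC 0
      have h2 : (0 : ℝ) ≤ k (0 + 1) := Nat.cast_nonneg _
      rw [pow_zero, mul_one] at this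
      linarith [Real.pi_pos]
    have him : ∀ q m, 10 ≤ (orbitApprox k q m).im := fun q m =>
      (log_bounds hmono h4 (hb q m).1 (hb q m).2).1
    have h1 := ih (n + 1)
    have h2 := ih 0
    rw [orbitApprox, orbitApprox, dist_add_right]
    refine (dist_sub_sub_le _ _ _ _).trans ?_
    have h3 := norm_log_sub_log_le (him p (n + 1)) (him (p + 1) (n + 1))
    have h4 := norm_log_sub_log_le (him p 0) (him (p + 1) 0)
    rw [← dist_eq_norm, ← dist_eq_norm] at h3 h4
    have h5 : (1 : ℝ) ≤ 2 ^ n := one_le_pow₀ (by norm_num)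
    have h6 : 0 ≤ C * (1 / 2 : ℝ) ^ p := by positivity
    rw [pow_succ, pow_zero] at *
    nlinarith [mul_le_mul_of_nonneg_left h5 h6]

/-- Existence of a parameter whose singular orbit has a prescribed itinerary. -/
lemma exists_parameter {k : ℕ → ℕ} (hmono : Monotone k) (h4 : ∀ n, 4 ≤ k n)
    (hexp : ∀ n, 10 * (k (n + 1) : ℝ) ≤ Real.exp (k n)) {C : ℝ}
    (hC : ∀ n, (k (n + 1) : ℝ) + Real.pi ≤ C * 2 ^ n) :
    ∃ l : ℂ, |l.im - 2 * Real.pi * k 0| ≤ Real.pi ∧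
      ∀ n, (k n : ℝ) ≤ ‖(expMap l)^[n + 1] 0‖ ∧ ‖(expMap l)^[n + 1] 0‖ ≤ 10 * k (n + 1) := by
  have hb := orbitApprox_bounds hmono h4 hexp
  have hcau : ∀ n, CauchySeq (fun p => orbitApprox k p n) := fun n =>
    cauchySeq_of_le_geometric (1 / 2) (C * 2 ^ n) (by norm_num)
      (fun p => dist_orbitApprox_le hmono h4 hexp hC p n)
  choose z hz using fun n => cauchySeq_tendsto_of_complete (hcau n)
  have hz1 : ∀ n, |(z n).re| ≤ k (n + 1) := fun n =>
    le_of_tendsto ((continuous_re.abs.tendsto _).comp (hz n))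
      (Eventually.of_forall fun p => (hb p n).1)
  have hz2 : ∀ n, |(z n).im - 2 * Real.pi * k n| ≤ Real.pi := fun n =>
    le_of_tendsto (((continuous_im.sub continuous_const).abs.tendsto _).comp (hz n))
      (Eventually.of_forall fun p => (hb p n).2)
  have hlb := fun n => log_bounds hmono h4 (hz1 n) (hz2 n)
  have hsl : ∀ n, z n ∈ slitPlane := fun n => Or.inr (by linarith [(hlb n).1] : 0 < (z n).im).ne'
  have heq : ∀ n, z n = log (z (n + 1)) - log (z 0) + 2 * Real.pi * k n * I := by
    intro n
    refine tendsto_nhds_unique ((tendsto_add_atTop_iff_nat 1).2 (hz n)) ?_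
    simp only [orbitApprox]
    exact (((hz (n + 1)).clog (hsl _)).sub ((hz 0).clog (hsl _))).add tendsto_const_nhds
  have hne : ∀ n, z n ≠ 0 := fun n => slitPlane_ne_zero (hsl n)
  have hstep : ∀ n, expMap (z 0) (z n) = z (n + 1) := by
    intro n
    have h2 : (2 * Real.pi * k n * I : ℂ) = (k n : ℕ) * (2 * Real.pi * I) := by ring
    rw [expMap, heq n, exp_add, exp_sub, exp_log (hne _), exp_log (hne _), h2,
      exp_nat_mul_two_pi_mul_I, mul_one]
    field_simp [hne 0]
  have horb : ∀ n, (expMap (z 0))^[n + 1] 0 = z n := by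
    intro n
    induction n with
    | zero => simp [expMap]
    | succ n ih => rw [Function.iterate_succ_apply', ih, hstep]
  refine ⟨z 0, hz2 0, fun n => ?_⟩
  rw [horb]
  exact (hlb n).2

lemma exists_level {N : ℕ → ℕ} (hN : StrictMono N) (h0 : N 0 = 0) :
    ∃ lev : ℕ → ℕ, ∀ n, N (lev n) ≤ n ∧ n < N (lev n + 1) := by
  refine ⟨fun n => Nat.findGreatest (fun j => N j ≤ n) n, fun n => ⟨?_, ?_⟩⟩
  · exact Nat.findGreatest_spec (P := fun j => N j ≤ n) (Nat.zero_le n) (by rw [h0]; omega)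
  · by_contra! h
    have h1 := Nat.le_findGreatest (P := fun j => N j ≤ n) ((hN.le_apply).trans h) h
    omega

/-- Growth conditions on the constants from which a singular itinerary is built. -/
structure Levels (K : ℕ) (κ : ℕ → ℕ) : Prop where
  exp_le : Real.exp 200 ≤ K
  base : 9 * (K : ℝ) * Real.exp (10 ^ 5) ≤ κ 0
  base_le : 10 * (κ 0 : ℝ) ≤ Real.exp K
  large : ∀ j : ℕ, Real.exp (60000 * ((j : ℝ) + 2) ^ 2) ≤ κ j
  succ_le : ∀ j : ℕ, 10 * (κ (j + 1) : ℝ) ≤ Real.exp (κ j)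
  mono : Monotone κ

lemma exists_levels : ∃ (K : ℕ) (κ : ℕ → ℕ), Levels K κ := by
  have hexp : ∀ {k : ℕ} {x y : ℝ}, 0 ≤ x → k * x ≤ y → (x + 1) ^ k ≤ Real.exp y :=
    fun hx hy => pow_lt_exp hx hy
  have h200 : (10 : ℝ) ^ 8 ≤ Real.exp 200 := by
    refine le_trans ?_ (hexp (k := 8) (x := 9) (by norm_num) (by norm_num))
    norm_num
  have he : (2 : ℝ) ≤ Real.exp 1 := by linarith [Real.add_one_le_exp (1 : ℝ)]
  have hceil : ∀ y : ℝ, 0 ≤ y → (⌈Real.exp y⌉₊ : ℝ) ≤ Real.exp (y + 1) := by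
    intro y hy
    have h1 := (Nat.ceil_lt_add_one (Real.exp_pos y).le).le
    have h2 := Real.one_le_exp hy
    rw [Real.exp_add]
    nlinarith
  have hceil10 : ∀ y : ℝ, 0 ≤ y → 10 * (⌈Real.exp y⌉₊ : ℝ) ≤ Real.exp (y + 5) := by
    intro y hy
    have h1 := hceil y hy
    have h2 : (16 : ℝ) ≤ Real.exp 4 := by
      refine le_trans ?_ (hexp (k := 4) (x := 1) (by norm_num) (by norm_num))
      norm_num
    rw [show y + 5 = (y + 1) + 4 by ring, Real.exp_add (y + 1)]
    nlinarith [Real.exp_pos (y + 1)]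
  refine ⟨⌈Real.exp 200⌉₊, fun j => ⌈Real.exp (10 ^ 6 * ((j : ℝ) + 1) ^ 2)⌉₊, ?_, ?_, ?_, ?_, ?_, ?_⟩
  · exact Nat.le_ceil _
  · have h1 := hceil10 200 (by norm_num)
    have h2 : Real.exp (200 + 5) * Real.exp (10 ^ 5) ≤
        Real.exp (10 ^ 6 * (((0 : ℕ) : ℝ) + 1) ^ 2) := by
      rw [← Real.exp_add, Real.exp_le_exp]; norm_num
    refine le_trans ?_ (h2.trans (Nat.le_ceil _))
    gcongr
    have : (0 : ℝ) ≤ (⌈Real.exp 200⌉₊ : ℝ) := Nat.cast_nonneg _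
    linarith
  · refine (hceil10 _ (by positivity)).trans (Real.exp_le_exp.2 ?_)
    have h1 : (10 : ℝ) ^ 8 ≤ (⌈Real.exp 200⌉₊ : ℝ) := h200.trans (Nat.le_ceil _)
    push_cast
    linarith
  · intro j
    refine le_trans (Real.exp_le_exp.2 ?_) (Nat.le_ceil _)
    have : (0 : ℝ) ≤ j := Nat.cast_nonneg j
    nlinarith
  · intro j
    have hj : (0 : ℝ) ≤ j := Nat.cast_nonneg j
    refine (hceil10 _ (by positivity)).trans (Real.exp_le_exp.2 ?_)
    refine le_trans ?_ (Nat.le_ceil _)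
    push_cast
    set y : ℝ := 10 ^ 6 * ((j : ℝ) + 1) ^ 2 with hy
    have hy6 : 10 ^ 6 ≤ y := by rw [hy]; nlinarith
    have h1 := hexp (k := 2) (x := y / 2) (y := y) (by linarith) (by push_cast; linarith)
    have h2 : 10 ^ 6 * ((j : ℝ) + 1 + 1) ^ 2 ≤ 4 * y := by rw [hy]; nlinarith
    nlinarith
  · intro i j hij
    dsimp only
    gcongr

/-- The threshold for real parts at level `j` when the level starts at time `n`. -/
noncomputable def threshold (κ : ℕ → ℕ) (j n : ℕ) : ℝ :=
  100 * (10 * (κ (j + 2) : ℝ)) ^ (n + 2) * Real.exp (60000 * ((j : ℝ) + 2) ^ 2)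

/-- A real comparison function for the exponential map. -/
noncomputable def compareExp (κ : ℕ → ℕ) (x : ℝ) : ℝ := 10 * (κ 0 : ℝ) * Real.exp (x + 1)

/-- Starting times of the levels. -/
noncomputable def levelStart (κ : ℕ → ℕ) : ℕ → ℕ
  | 0 => 0
  | j + 1 => ⌈(compareExp κ)^[2 * (j + 1) ^ 2] (threshold κ j (levelStart κ j))⌉₊ + 4

lemma Levels.one_le {K : ℕ} {κ : ℕ → ℕ} (h : Levels K κ) (j : ℕ) : (1 : ℝ) ≤ κ j :=
  (Real.one_le_exp (by positivity)).trans (h.large j)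

lemma Levels.le_apply {K : ℕ} {κ : ℕ → ℕ} (h : Levels K κ) (j : ℕ) : (j : ℝ) ≤ κ j := by
  refine le_trans ?_ (h.large j)
  have hj : (0 : ℝ) ≤ j := Nat.cast_nonneg j
  have := Real.add_one_le_exp (60000 * ((j : ℝ) + 2) ^ 2)
  nlinarith

lemma Levels.le_compareExp {K : ℕ} {κ : ℕ → ℕ} (h : Levels K κ) (x : ℝ) : x ≤ compareExp κ x := by
  have h1 := h.one_le 0
  have h2 := Real.add_one_le_exp (x + 1)
  have h3 := Real.exp_pos (x + 1)
  rw [compareExp]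
  nlinarith

lemma compareExp_monotone (κ : ℕ → ℕ) : Monotone (compareExp κ) := by
  intro x y hxy
  unfold compareExp
  gcongr

lemma pow_le_threshold (κ : ℕ → ℕ) (j n : ℕ) :
    (10 * (κ (j + 2) : ℝ)) ^ (n + 2) ≤ threshold κ j n := by
  have h1 : 1 ≤ Real.exp (60000 * ((j : ℝ) + 2) ^ 2) := Real.one_le_exp (by positivity)
  have h2 : 0 ≤ (10 * (κ (j + 2) : ℝ)) ^ (n + 2) := by positivity
  rw [threshold]
  nlinarith

lemma Levels.add_two_lt_threshold {K : ℕ} {κ : ℕ → ℕ} (h : Levels K κ) (j n : ℕ) :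
    (n : ℝ) + 2 < threshold κ j n := by
  refine lt_of_lt_of_le ?_ (pow_le_threshold κ j n)
  have h1 : ((n + 2 : ℕ) : ℝ) < 2 ^ (n + 2) := by exact_mod_cast Nat.lt_two_pow_self
  push_cast at h1
  refine h1.trans_le ?_
  have := h.one_le (j + 2)
  gcongr
  linarith

lemma Levels.le_threshold {K : ℕ} {κ : ℕ → ℕ} (h : Levels K κ) (j n : ℕ) :
    (κ (j + 1) : ℝ) ≤ threshold κ j n := by
  refine le_trans ?_ (pow_le_threshold κ j n)
  have h1 := h.one_le (j + 2)
  have h2 : (κ (j + 1) : ℝ) ≤ κ (j + 2) := by exact_mod_cast h.mono (Nat.le_succ _)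
  have h3 : (10 * (κ (j + 2) : ℝ)) ^ 1 ≤ (10 * (κ (j + 2) : ℝ)) ^ (n + 2) :=
    pow_le_pow_right₀ (by linarith) (by omega)
  rw [pow_one] at h3
  linarith

lemma iterate_add_four_le_levelStart (κ : ℕ → ℕ) (j : ℕ) :
    (compareExp κ)^[2 * (j + 1) ^ 2] (threshold κ j (levelStart κ j)) + 4 ≤
      levelStart κ (j + 1) := by
  rw [levelStart]
  push_cast
  gcongr
  exact Nat.le_ceil _

lemma Levels.threshold_add_four_le {K : ℕ} {κ : ℕ → ℕ} (h : Levels K κ) (j : ℕ) :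
    threshold κ j (levelStart κ j) + 4 ≤ levelStart κ (j + 1) := by
  refine le_trans ?_ (iterate_add_four_le_levelStart κ j)
  gcongr
  exact le_iterate_of_le h.le_compareExp _ _

lemma Levels.levelStart_strictMono {K : ℕ} {κ : ℕ → ℕ} (h : Levels K κ) :
    StrictMono (levelStart κ) := by
  refine strictMono_nat_of_lt_succ fun j => ?_
  have h1 := h.threshold_add_four_le j
  have h2 := h.add_two_lt_threshold j (levelStart κ j)
  have : (levelStart κ j : ℝ) < levelStart κ (j + 1) := by linarith
  exact_mod_cast this

lemma Levels.le_levelStart {K : ℕ} {κ : ℕ → ℕ} (h : Levels K κ) (j : ℕ) :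
    κ (j + 1) ≤ levelStart κ (j + 1) := by
  have h1 := h.threshold_add_four_le j
  have h2 := h.le_threshold j (levelStart κ j)
  have : (κ (j + 1) : ℝ) ≤ levelStart κ (j + 1) := by linarith
  exact_mod_cast this

lemma four_le_levelStart (κ : ℕ → ℕ) (j : ℕ) : 4 ≤ levelStart κ (j + 1) := by
  rw [levelStart]; omega

/-- An itinerary realising the levels. -/
structure Itinerary (K : ℕ) (κ : ℕ → ℕ) (k : ℕ → ℕ) : Prop where
  zero : k 0 = K
  mono : Monotone k
  lower : ∀ j n : ℕ, 1 ≤ n → levelStart κ j ≤ n → κ j ≤ k n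
  upper : ∀ j n : ℕ, n < levelStart κ (j + 1) → k n ≤ κ j
  exp_le : ∀ n, 10 * (k (n + 1) : ℝ) ≤ Real.exp (k n)
  growth : ∀ n, k n ≤ κ 0 + n

lemma Levels.le_base {K : ℕ} {κ : ℕ → ℕ} (h : Levels K κ) : K ≤ κ 0 := by
  have h1 := h.base
  have h2 := Real.one_le_exp (show (0 : ℝ) ≤ 10 ^ 5 by norm_num)
  have h3 : (0 : ℝ) ≤ K := Nat.cast_nonneg K
  have : (K : ℝ) ≤ κ 0 := by nlinarith
  exact_mod_cast this

lemma Levels.exists_itinerary {K : ℕ} {κ : ℕ → ℕ} (h : Levels K κ) :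
    ∃ k, Itinerary K κ k := by
  have hN := h.levelStart_strictMono
  obtain ⟨lev, hlev⟩ := exists_level hN rfl
  have hle : ∀ j n, levelStart κ j ≤ n → j ≤ lev n := fun j n hj => by
    have := hN.lt_iff_lt.1 (hj.trans_lt (hlev n).2)
    omega
  have hge : ∀ j n, n < levelStart κ (j + 1) → lev n ≤ j := fun j n hj => by
    have := hN.lt_iff_lt.1 ((hlev n).1.trans_lt hj)
    omega
  have hlevm : Monotone lev := fun m n hmn => hle _ _ ((hlev m).1.trans hmn)
  have hsucc : ∀ n, lev (n + 1) ≤ lev n + 1 := fun n => by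
    refine hge _ _ ?_
    have h1 := hN (show lev n + 1 < lev n + 1 + 1 by omega)
    have h2 := (hlev n).2
    omega
  have hlev0 : ∀ n, n < 4 → lev n = 0 := fun n hn =>
    Nat.le_zero.1 (hge 0 n (hn.trans_le (four_le_levelStart κ 0)))
  have hκ : ∀ n, κ (lev n) ≤ κ 0 + n := fun n => by
    rcases hj : lev n with _ | j
    · omega
    · have h1 := (hlev n).1
      rw [hj] at h1
      have := h.le_levelStart j
      omega
  refine ⟨fun n => if n = 0 then K else κ (lev n), ?_, ?_, ?_, ?_, ?_, ?_⟩
  · simp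
  · refine monotone_nat_of_le_succ fun n => ?_
    rcases Nat.eq_zero_or_pos n with rfl | hn
    · simpa using h.le_base.trans (h.mono (Nat.zero_le _))
    · simpa [hn.ne'] using h.mono (hlevm (Nat.le_succ n))
  · intro j n hn hj
    simpa [show n ≠ 0 by omega] using h.mono (hle j n hj)
  · intro j n hj
    rcases Nat.eq_zero_or_pos n with rfl | hn
    · simpa using h.le_base.trans (h.mono (Nat.zero_le _))
    · simpa [hn.ne'] using h.mono (hge j n hj)
  · intro n
    rcases Nat.eq_zero_or_pos n with rfl | hn
    · simpa [hlev0 1 (by norm_num)] using h.base_le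
    · have h1 : (κ (lev (n + 1)) : ℝ) ≤ κ (lev n + 1) := by exact_mod_cast h.mono (hsucc n)
      have h2 := h.succ_le (lev n)
      simpa [hn.ne'] using (by linarith : 10 * (κ (lev (n + 1)) : ℝ) ≤ Real.exp (κ (lev n)))
  · intro n
    rcases Nat.eq_zero_or_pos n with rfl | hn
    · simpa using h.le_base
    · simpa [hn.ne'] using hκ n

/-- The singular orbit of `expMap l` follows the itinerary `k`. -/
structure Follows (l : ℂ) (k : ℕ → ℕ) : Prop where
  im : |l.im - 2 * Real.pi * k 0| ≤ Real.pi
  le_norm : ∀ n, (k n : ℝ) ≤ ‖(expMap l)^[n + 1] 0‖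
  norm_le : ∀ n, ‖(expMap l)^[n + 1] 0‖ ≤ 10 * k (n + 1)

lemma exists_follows {K : ℕ} {κ k : ℕ → ℕ} (h : Levels K κ) (hk : Itinerary K κ k) :
    ∃ l, Follows l k := by
  have hpi := Real.pi_lt_d2
  have hK : (4 : ℝ) ≤ K := by
    have := h.exp_le
    linarith [Real.add_one_le_exp (200 : ℝ)]
  have h4 : ∀ n, 4 ≤ k n := fun n => by
    have h1 := hk.mono (Nat.zero_le n)
    rw [hk.zero] at h1
    have : 4 ≤ K := by exact_mod_cast hK
    omega
  obtain ⟨l, h1, h2⟩ := exists_parameter hk.mono h4 hk.exp_le (C := κ 0 + 5) (fun n => by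
    have h3 : (k (n + 1) : ℝ) ≤ κ 0 + (n + 1) := by exact_mod_cast hk.growth (n + 1)
    have h4 : (n : ℝ) + 1 ≤ 2 ^ n := by exact_mod_cast Nat.lt_two_pow_self (n := n)
    have h5 : (0 : ℝ) ≤ κ 0 := Nat.cast_nonneg _
    have h6 : (1 : ℝ) ≤ 2 ^ n := one_le_pow₀ (by norm_num)
    nlinarith)
  exact ⟨l, h1, fun n => (h2 n).1, fun n => (h2 n).2⟩

lemma norm_mul_exp_re (n : ℕ) :
    ‖(expMap l)^[n + 2] 0‖ = ‖l‖ * Real.exp ((expMap l)^[n + 1] 0).re := by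
  rw [Function.iterate_succ_apply', norm_expMap]

lemma expMap_zero : expMap l 0 = l := by simp [expMap]

lemma Itinerary.of_lt_four {K : ℕ} {κ k : ℕ → ℕ} (hk : Itinerary K κ k) {n : ℕ} (hn : n < 4) :
    (k n : ℝ) ≤ κ 0 := by
  exact_mod_cast hk.upper 0 n (hn.trans_le (four_le_levelStart κ 0))

lemma Itinerary.base_le {K : ℕ} {κ k : ℕ → ℕ} (hk : Itinerary K κ k) (n : ℕ) :
    (κ 0 : ℝ) ≤ k (n + 1) := by
  exact_mod_cast hk.lower 0 (n + 1) (by omega) (Nat.zero_le _)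

lemma norm_le_of_follows {K : ℕ} {κ k : ℕ → ℕ} (h : Levels K κ) (hk : Itinerary K κ k)
    (hl : Follows l k) : ‖l‖ ≤ 9 * K := by
  have hpi := Real.pi_lt_d2
  have hpi0 := Real.pi_pos
  have hK : (200 : ℝ) ≤ K := by
    have := h.exp_le
    linarith [Real.add_one_le_exp (200 : ℝ)]
  have h1 := hl.le_norm 0
  have h2 := hl.norm_le 0
  have h3 := hl.le_norm 1
  have h4 := hl.norm_le 1
  have h5 := hk.of_lt_four (n := 1) (by norm_num)
  have h6 := hk.of_lt_four (n := 2) (by norm_num)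
  have h7 := hk.base_le 0
  have him := abs_le.1 hl.im
  have hb := h.base_le
  rw [norm_mul_exp_re] at h3 h4
  simp only [zero_add, Function.iterate_one, expMap_zero] at h1 h2 h3 h4 h7
  rw [hk.zero] at h1 him
  have hκ := h.one_le 0
  have hre1 : l.re ≤ K := by
    rw [← Real.exp_le_exp]
    have : 1 * Real.exp l.re ≤ ‖l‖ * Real.exp l.re := by gcongr; linarith
    norm_num at h4
    linarith
  have hre2 : -l.re ≤ K := by
    rw [← Real.exp_le_exp, Real.exp_neg]
    have h8 : 1 ≤ ‖l‖ * Real.exp l.re := by linarith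
    have h9 : (Real.exp l.re)⁻¹ ≤ ‖l‖ := by
      rw [inv_le_iff_one_le_mul₀ (Real.exp_pos _)]; linarith
    linarith
  refine (norm_le_abs_re_add_abs_im l).trans ?_
  have h10 : |l.re| ≤ K := abs_le.2 ⟨by linarith, hre1⟩
  have h11 : |l.im| ≤ 2 * Real.pi * K + Real.pi := abs_le.2 ⟨by nlinarith, by linarith⟩
  nlinarith

lemma re_ge_of_follows {K : ℕ} {κ k : ℕ → ℕ} (h : Levels K κ) (hk : Itinerary K κ k)
    (hl : Follows l k) (n : ℕ) : 10 ^ 5 ≤ ((expMap l)^[n + 1] 0).re := by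
  have hK : (200 : ℝ) ≤ K := by
    have := h.exp_le
    linarith [Real.add_one_le_exp (200 : ℝ)]
  have h1 := norm_le_of_follows h hk hl
  have h2 := hl.le_norm (n + 1)
  have h3 := hk.base_le n
  rw [norm_mul_exp_re] at h2
  rw [← Real.exp_le_exp]
  have h4 := h.base
  have h5 : 9 * (K : ℝ) * Real.exp (10 ^ 5) ≤ 9 * K * Real.exp ((expMap l)^[n + 1] 0).re := by
    refine (h4.trans (h3.trans h2)).trans ?_
    gcongr
  exact le_of_mul_le_mul_left h5 (by linarith)

lemma Itinerary.tendsto {K : ℕ} {κ k : ℕ → ℕ} (h : Levels K κ) (hk : Itinerary K κ k) :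
    Tendsto k atTop atTop := by
  refine tendsto_atTop_atTop_of_monotone hk.mono fun b => ⟨levelStart κ b + 1, ?_⟩
  have h1 : b ≤ κ b := by exact_mod_cast h.le_apply b
  exact h1.trans (hk.lower b _ (by omega) (by omega))

lemma tendsto_re_of_follows {K : ℕ} {κ k : ℕ → ℕ} (h : Levels K κ) (hk : Itinerary K κ k)
    (hl : Follows l k) (hl0 : l ≠ 0) :
    Tendsto (fun n => ((expMap l)^[n] 0).re) atTop atTop := by
  rw [← tendsto_add_atTop_iff_nat 1]
  have hlp := norm_pos_iff.2 hl0
  have h1 : Tendsto (fun n => Real.log ((k (n + 1) : ℝ) / ‖l‖)) atTop atTop :=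
    Real.tendsto_log_atTop.comp ((tendsto_natCast_atTop_atTop.comp
      ((tendsto_add_atTop_iff_nat 1).2 (hk.tendsto h))).atTop_div_const hlp)
  refine tendsto_atTop_mono (fun n => ?_) h1
  have h2 := hl.le_norm (n + 1)
  have h3 := hk.base_le n
  have h4 := h.one_le 0
  rw [norm_mul_exp_re] at h2
  rw [Real.log_le_iff_le_exp (div_pos (by linarith) hlp), div_le_iff₀ hlp]
  linarith

lemma dnorm_le_of_follows {K : ℕ} {κ k : ℕ → ℕ} (hk : Itinerary K κ k)
    (hl : Follows l k) {j n : ℕ} (hn : n < levelStart κ (j + 1)) :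
    dnorm l n 0 ≤ (10 * (κ j : ℝ)) ^ n := by
  unfold dnorm
  calc ∏ i ∈ Finset.range n, ‖(expMap l)^[i + 1] 0‖ ≤ ∏ _i ∈ Finset.range n, (10 * (κ j : ℝ)) := by
        refine Finset.prod_le_prod (fun _ _ => norm_nonneg _) fun i hi => ?_
        refine (hl.norm_le i).trans ?_
        have : k (i + 1) ≤ κ j := hk.upper j (i + 1) (by
          have := Finset.mem_range.1 hi
          omega)
        have : (k (i + 1) : ℝ) ≤ κ j := by exact_mod_cast this
        linarith
    _ = _ := by simp

lemma recurrence_of_follows {K : ℕ} {κ k : ℕ → ℕ} (h : Levels K κ) (hk : Itinerary K κ k)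
    (hl : Follows l k) : Recurrence l (compareExp κ) (fun j => threshold κ j (levelStart κ j))
      (fun j => (compareExp κ)^[2 * (j + 2) ^ 2] (threshold κ (j + 1) (levelStart κ (j + 1)))) := by
  have hK := h.exp_le
  have hlK := hl.le_norm 0
  rw [hk.zero] at hlK
  have hlu := hl.norm_le 0
  have hk1 := hk.of_lt_four (n := 1) (by norm_num)
  simp only [zero_add, Function.iterate_one, expMap_zero] at hlK hlu
  have hl200 : Real.exp 200 ≤ ‖l‖ := hK.trans hlK
  have hl1 : 1 ≤ ‖l‖ := (Real.one_le_exp (by norm_num)).trans hl200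
  have hA := norm_ge_of_re' (re_ge_of_follows h hk hl)
  have hexp : ∀ j : ℕ, Real.exp (60000 * ((j : ℝ) + 2) ^ 2) ≤ threshold κ j (levelStart κ j) := by
    intro j
    have h1 : 1 ≤ (10 * (κ (j + 2) : ℝ)) ^ (levelStart κ j + 2) :=
      one_le_pow₀ (by linarith [h.one_le (j + 2)])
    have h2 := Real.exp_pos (60000 * ((j : ℝ) + 2) ^ 2)
    rw [threshold]
    nlinarith
  refine ⟨compareExp_monotone κ, h.le_compareExp, fun x => ?_, ?_, fun j => ?_, fun j => le_rfl, ?_⟩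
  · rw [compareExp]
    gcongr
    linarith
  · refine tendsto_atTop_mono (fun j => ?_) tendsto_natCast_atTop_atTop
    refine le_trans ?_ (hexp j)
    have := Real.add_one_le_exp (60000 * ((j : ℝ) + 2) ^ 2)
    nlinarith [(Nat.cast_nonneg j : (0 : ℝ) ≤ j)]
  · refine le_trans ?_ (hexp j)
    have := Real.add_one_le_exp (60000 * ((j : ℝ) + 2) ^ 2)
    nlinarith [(Nat.cast_nonneg j : (0 : ℝ) ≤ j)]
  · intro j x hx hxτ
    set N := levelStart κ j with hN
    have hκ2 := h.one_le (j + 2)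
    set P : ℝ := (10 * (κ (j + 2) : ℝ)) ^ (N + 1) with hP
    have hP1 : 1 ≤ P := one_le_pow₀ (by linarith)
    set e := Real.exp (60000 * ((j : ℝ) + 2) ^ 2) with he
    have he1 : 1 ≤ e := Real.one_le_exp (by positivity)
    have hthr : threshold κ j N = 100 * (P * (10 * (κ (j + 2) : ℝ))) * e := by
      rw [threshold, hP, ← pow_succ]
    have hlκ : ‖l‖ ≤ 10 * κ (j + 2) := by
      have : (κ 0 : ℝ) ≤ κ (j + 2) := by exact_mod_cast h.mono (Nat.zero_le _)
      linarith
    have hxP : 100 * (P * ‖l‖) ≤ x := by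
      refine le_trans ?_ hx
      rw [hthr]
      have h1 : P * ‖l‖ ≤ P * (10 * κ (j + 2)) := by gcongr
      have h2 : 0 ≤ P * (10 * (κ (j + 2) : ℝ)) := by positivity
      nlinarith
    have hxe : x + 1 ≤ Real.exp x := Real.add_one_le_exp x
    set ρ := ‖l‖ * Real.exp (-x) with hρ
    have hρ0 : 0 < ρ := mul_pos (by linarith) (Real.exp_pos _)
    have hρx : ρ * Real.exp x = ‖l‖ := by
      rw [hρ, mul_assoc, ← Real.exp_add]; simp
    have hρP : ρ * P < 1 / 100 := by
      have h1 : 100 * (P * ‖l‖) < Real.exp x := by linarith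
      rw [← hρx] at h1
      have h2 : (100 * (P * ρ)) * Real.exp x < 1 * Real.exp x := by linarith
      have := lt_of_mul_lt_mul_right h2 (Real.exp_pos x).le
      linarith
    have hρ1 : ρ < 1 / 100 := by nlinarith
    obtain ⟨m, hm1, hm2⟩ := exists_scale hA hρ0 hρ1
    have hmono := h.levelStart_strictMono
    have hmN : N + 1 ≤ m := by
      by_contra! hlt
      have hs1 := hmono (show j < j + 1 by omega)
      have hs2 := hmono (show j + 1 < j + 2 by omega)
      have hs3 := hmono (show j + 2 < j + 2 + 1 by omega)
      have h1 := dnorm_le_of_follows hk hl (j := j + 2) (n := N + 1) (by omega)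
      have h2 := dnorm_zero_le hA (show m + 1 ≤ N + 1 by omega)
      have h3 : ρ * dnorm l (m + 1) 0 ≤ ρ * P := by
        gcongr
        exact h2.trans h1
      linarith
    have hmx : (m : ℝ) < x := by
      have h1 := pow_le_dnorm hA m
      have h2 : Real.exp m ≤ 200 ^ m := by
        rw [← mul_one (m : ℝ), Real.exp_nat_mul]
        gcongr
        linarith [Real.exp_one_lt_d9]
      have h3 : ρ * Real.exp m < ρ * Real.exp x := by
        rw [hρx]
        have : ρ * Real.exp m ≤ ρ * dnorm l m 0 := by gcongr; exact h2.trans h1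
        linarith
      exact Real.exp_lt_exp.1 (lt_of_mul_lt_mul_left h3 hρ0.le)
    have hmN2 : m + 3 < levelStart κ (j + 2) := by
      have h1 := iterate_add_four_le_levelStart κ (j + 1)
      have h2 : (m : ℝ) + 3 < levelStart κ (j + 2) := by
        refine lt_of_lt_of_le ?_ h1
        rw [show j + 1 + 1 = j + 2 from rfl]
        linarith
      exact_mod_cast h2
    have hlow : ∀ i, m ≤ i → e ≤ ‖(expMap l)^[i + 1] 0‖ := fun i hi => by
      have h1 : (κ j : ℝ) ≤ k i := by exact_mod_cast hk.lower j i (by omega) (by omega)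
      exact (h.large j).trans (h1.trans (hl.le_norm i))
    have hup : ∀ i, i ≤ m + 1 → ‖(expMap l)^[i + 1] 0‖ ≤ 10 * κ (j + 2) := fun i hi => by
      have h1 : (k (i + 1) : ℝ) ≤ κ (j + 1) := by
        exact_mod_cast hk.upper (j + 1) (i + 1) (by
          rw [show j + 1 + 1 = j + 2 from rfl]; omega)
      have h2 : (κ (j + 1) : ℝ) ≤ κ (j + 2) := by exact_mod_cast h.mono (Nat.le_succ _)
      have := hl.norm_le i
      linarith
    refine ⟨m, 10 * κ (j + 2), hm1, hm2, hlow m le_rfl, hlow (m + 1) (by omega), hup m (by omega),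
      hup (m + 1) le_rfl, ?_⟩
    rw [hthr]
    have h2 : 0 ≤ e * (10 * (κ (j + 2) : ℝ)) := by positivity
    nlinarith

end ExpErgodic

/-- There exists an escaping parameter `l ≠ 0` for the exponential family
`f_l(z) = l * exp z`: the real parts of the iterates of the singular value `0`
tend to `∞`, and `f_l` is ergodic with respect to planar Lebesgue measure. -/
theorem exists_escaping_ergodic_exponential :
    ∃ l : ℂ, l ≠ 0 ∧
      Tendsto (fun n : ℕ => (((fun z : ℂ => l * Complex.exp z)^[n]) 0).re)
        atTop atTop ∧
      ∀ A : Set ℂ, MeasurableSet A →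
        (fun z : ℂ => l * Complex.exp z) ⁻¹' A = A →
        volume A = 0 ∨ volume Aᶜ = 0 := by
  obtain ⟨K, κ, h⟩ := ExpErgodic.exists_levels
  obtain ⟨k, hk⟩ := h.exists_itinerary
  obtain ⟨l, hl⟩ := ExpErgodic.exists_follows h hk
  have hle : Real.exp 200 ≤ ‖l‖ := by
    have h1 := hl.le_norm 0
    rw [hk.zero] at h1
    simp only [zero_add, Function.iterate_one, ExpErgodic.expMap_zero] at h1
    exact h.exp_le.trans h1
  have hl0 : l ≠ 0 := norm_pos_iff.1 ((Real.exp_pos _).trans_le hle)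
  exact ⟨l, hl0, ExpErgodic.tendsto_re_of_follows h hk hl hl0, fun A hA hinv =>
    ExpErgodic.ergodic_of_recurrence hle (ExpErgodic.re_ge_of_follows h hk hl)
      (ExpErgodic.recurrence_of_follows h hk hl) hA hinv⟩
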